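/- (Huh–Wang) Let M be a loopless matroid of rank r on a finite ground set E that is representable over some field, and for 0 ≤ k ≤ r let W_k(M) denote the number of flats of M of rank k (the Whitney numbers of the second kind). Then the first half of this sequence is nondecreasing: W_1(M) ≤ W_2(M) ≤ ⋯ ≤ W_{⌊r/2⌋}(M). -/

import Mathlib

/-- A matroid on a finite ground set `E`, given by the independence axioms (I1)-(I3). -/
structure FinMatroid (E : Type*) [Fintype E] [DecidableEq E] where
  Indep : Finset E → Prop
  indep_empty : Indep ∅
  indep_subset : ∀ ⦃I J : Finset E⦄, Indep J → I ⊆ J → Indep I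
  indep_exchange : ∀ ⦃I J : Finset E⦄, Indep I → Indep J → I.card < J.card →
    ∃ e ∈ J, e ∉ I ∧ Indep (insert e I)

namespace FinMatroid

variable {E : Type*} [Fintype E] [DecidableEq E]

open Classical in
/-- The rank of a subset `A`: the maximal cardinality of an independent subset of `A`. -/
noncomputable def rank (M : FinMatroid E) (A : Finset E) : ℕ :=
  (A.powerset.filter fun I => M.Indep I).sup Finset.card

/-- The rank of the matroid. -/
noncomputable def rk (M : FinMatroid E) : ℕ := M.rank Finset.univ

/-- The closure of a subset `A`: all elements `x` with `r(A ∪ {x}) = r(A)`. -/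
noncomputable def closure (M : FinMatroid E) (A : Finset E) : Finset E :=
  Finset.univ.filter fun x => M.rank (insert x A) = M.rank A

/-- A flat is a closed subset. -/
def IsFlat (M : FinMatroid E) (F : Finset E) : Prop := M.closure F = F

/-- A matroid is loopless if the closure of the empty set is empty. -/
def Loopless (M : FinMatroid E) : Prop := M.closure ∅ = ∅

/-- A basis is a maximal independent set. -/
def IsBase (M : FinMatroid E) (B : Finset E) : Prop :=
  M.Indep B ∧ ∀ ⦃J⦄, M.Indep J → B ⊆ J → J = B

open Classical in
/-- The finset of all flats of `M`. -/
noncomputable def flats (M : FinMatroid E) : Finset (Finset E) :=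
  Finset.univ.filter fun F => M.IsFlat F

open Classical in
/-- `mu` is the Möbius function of the lattice of flats of `M`: it satisfies `mu F F = 1`,
`mu F F' = 0` when `¬ F ⊆ F'`, and for `F ⊂ F'` the sum of `mu F G` over the flats
`F ⊆ G ⊆ F'` vanishes. These properties determine `mu` uniquely on pairs of flats. -/
def IsMobius (M : FinMatroid E) (mu : Finset E → Finset E → ℤ) : Prop :=
  (∀ F ∈ M.flats, mu F F = 1) ∧
  (∀ F ∈ M.flats, ∀ F' ∈ M.flats, ¬F ⊆ F' → mu F F' = 0) ∧
  (∀ F ∈ M.flats, ∀ F' ∈ M.flats, F ⊂ F' →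
    ∑ G ∈ M.flats.filter (fun G => F ⊆ G ∧ G ⊆ F'), mu F G = 0)

open Classical in
/-- The characteristic polynomial of a matroid `M` (relative to the Möbius function `mu` of
its lattice of flats): `χ_M(t) = Σ_{F ∈ L(M)} μ(∅,F) t^{r(E) - r(F)}` if `M` is loopless,
and `0` if `M` has a loop. -/
noncomputable def charPoly (M : FinMatroid E) (mu : Finset E → Finset E → ℤ) : Polynomial ℤ :=
  if M.Loopless then
    ∑ F ∈ M.flats, Polynomial.C (mu ∅ F) * Polynomial.X ^ (M.rk - M.rank F)
  else 0

end FinMatroid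

namespace FinMatroid

variable {E : Type*} [Fintype E] [DecidableEq E]

/-- A matroid is representable over some field if there are a field `K`, a `K`-vector space
`V`, and a map `φ : E → V` such that a set `I` is independent in `M` exactly when `φ` is
injective on `I` and `φ(I)` is linearly independent over `K`. -/
def Representable (M : FinMatroid E) : Prop :=
  ∃ (K : Type) (_ : Field K) (V : Type) (_ : AddCommGroup V),
    ∃ (_ : Module K V) (φ : E → V),
      ∀ I : Finset E, M.Indep I ↔
        (Set.InjOn φ (I : Set E) ∧
          LinearIndependent K (fun v : (φ '' (I : Set E)) => (v : V)))

open Classical in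
/-- The Whitney numbers of the second kind: `W k` is the number of flats of `M` of rank `k`. -/
noncomputable def whitneySecond (M : FinMatroid E) (k : ℕ) : ℕ :=
  ((Finset.univ : Finset (Finset E)).filter fun F => M.IsFlat F ∧ M.rank F = k).card

end FinMatroid


namespace HW
open Classical
set_option linter.unusedSectionVars false

section Ring
variable (F V : Type*) [Field F] [AddCommGroup V] [Module F V] [Finite V]

/-- The graded Möbius algebra of the lattice of all subspaces of a finite vector space. -/
def GrM : Type _ := Submodule F V → ℝ

noncomputable instance : AddCommGroup (GrM F V) := inferInstanceAs (AddCommGroup (Submodule F V → ℝ))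
noncomputable instance : Module ℝ (GrM F V) := inferInstanceAs (Module ℝ (Submodule F V → ℝ))
noncomputable instance : Fintype (Submodule F V) := Fintype.ofFinite _
instance : FiniteDimensional ℝ (GrM F V) := inferInstanceAs (FiniteDimensional ℝ (Submodule F V → ℝ))

variable {F V}

instance : CoeFun (GrM F V) (fun _ => Submodule F V → ℝ) := ⟨fun a => a⟩

/-- Dimension of a subspace. -/
noncomputable abbrev dm (U : Submodule F V) : ℕ := Module.finrank F U

theorem GrM.ext' {a b : GrM F V} (h : ∀ U, a U = b U) : a = b := funext h
@[simp] theorem add_app (a b : GrM F V) (U : Submodule F V) : (a + b) U = a U + b U := rfl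
@[simp] theorem sub_app (a b : GrM F V) (U : Submodule F V) : (a - b) U = a U - b U := rfl
@[simp] theorem neg_app (a : GrM F V) (U : Submodule F V) : (-a) U = - a U := rfl
@[simp] theorem zero_app (U : Submodule F V) : (0 : GrM F V) U = 0 := rfl
@[simp] theorem smul_app (c : ℝ) (a : GrM F V) (U : Submodule F V) : (c • a) U = c * a U := rfl

/-- Evaluation at `T` as a linear functional. -/
def ev (T : Submodule F V) : GrM F V →ₗ[ℝ] ℝ where
  toFun a := a T
  map_add' _ _ := rfl
  map_smul' _ _ := rfl
@[simp] theorem ev_apply (T : Submodule F V) (a : GrM F V) : ev T a = a T := rfl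

@[simp] theorem sum_app {ι : Type*} (s : Finset ι) (f : ι → GrM F V) (U : Submodule F V) :
    (∑ i ∈ s, f i) U = ∑ i ∈ s, f i U := map_sum (ev U) f s

/-- The basis element attached to a subspace. -/
noncomputable def y (U : Submodule F V) : GrM F V := fun X => if X = U then 1 else 0

theorem y_app (U X : Submodule F V) : y U X = if X = U then 1 else 0 := rfl

theorem eq_sum_y (a : GrM F V) : a = ∑ U, a U • y U := by
  apply GrM.ext'; intro X
  rw [sum_app, Finset.sum_eq_single X]
  · simp [y_app]
  · intro b _ hb; simp [y_app, hb.symm]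
  · simp

theorem hom_ext {A : Type*} [AddCommGroup A] [Module ℝ A] {f g : GrM F V →ₗ[ℝ] A}
    (h : ∀ U, f (y U) = g (y U)) : f = g := by
  apply LinearMap.ext; intro a
  rw [eq_sum_y a]
  simp [map_sum, h]

/-- Product of basis elements. -/
noncomputable def yy (U W : Submodule F V) : GrM F V := if Disjoint U W then y (U ⊔ W) else 0

/-- The multiplication as a bilinear map. -/
noncomputable def mulL : GrM F V →ₗ[ℝ] GrM F V →ₗ[ℝ] GrM F V :=
  ∑ U : Submodule F V, ∑ W : Submodule F V,
    (ev U).smulRight ((ev W).smulRight (yy U W))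

theorem mulL_apply (a b : GrM F V) : mulL a b = ∑ U, ∑ W, (a U * b W) • yy U W := by
  simp [mulL, LinearMap.sum_apply, smul_smul, Finset.smul_sum]

theorem mulL_y (U W : Submodule F V) : mulL (y U) (y W) = yy U W := by
  rw [mulL_apply, Finset.sum_eq_single U, Finset.sum_eq_single W]
  · simp [y_app]
  · intro b _ hb; simp [y_app, hb]
  · simp
  · intro b _ hb; simp [y_app, hb]
  · simp

theorem yy_comm (U W : Submodule F V) : yy U W = yy W U := by
  simp [yy, disjoint_comm, sup_comm]

theorem mulL_comm (a b : GrM F V) : mulL a b = mulL b a := by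
  have : (mulL : GrM F V →ₗ[ℝ] GrM F V →ₗ[ℝ] GrM F V) = mulL.flip := by
    apply hom_ext; intro U; apply hom_ext; intro W
    simp [mulL_y, yy_comm]
  conv_lhs => rw [this]
  rfl

theorem mulL_assoc_y (U W Z : Submodule F V) :
    mulL (mulL (y U) (y W)) (y Z) = mulL (y U) (mulL (y W) (y Z)) := by
  rw [mulL_y, mulL_y]
  unfold yy
  by_cases h1 : Disjoint U W <;> by_cases h2 : Disjoint W Z <;>
    simp only [h1, h2, if_true, if_false, mulL_y, map_zero, LinearMap.zero_apply, yy]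
  · by_cases h3 : Disjoint (U ⊔ W) Z
    · rw [if_pos h3, if_pos (h1.disjoint_sup_right_of_disjoint_sup_left h3), sup_assoc]
    · rw [if_neg h3, if_neg]
      intro h4; exact h3 (h2.disjoint_sup_left_of_disjoint_sup_right h4)
  · rw [if_neg]; intro h; exact h2 (h.mono_left le_sup_right)
  · rw [if_neg]; intro h; exact h1 (h.mono_right le_sup_left)

theorem mulL_assoc (a b c : GrM F V) : mulL (mulL a b) c = mulL a (mulL b c) := by
  have h1 : ∀ U W, mulL (mulL (y U) (y W)) = (mulL (y U)) ∘ₗ (mulL (y W) : GrM F V →ₗ[ℝ] GrM F V) := by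
    intro U W; apply hom_ext; intro Z; exact mulL_assoc_y U W Z
  have h2 : ∀ U, ∀ c : GrM F V, mulL.flip c ∘ₗ mulL (y U) = (mulL (y U)) ∘ₗ mulL.flip c := by
    intro U c; apply hom_ext; intro W
    exact LinearMap.congr_fun (h1 U W) c
  have h3 : mulL.flip c ∘ₗ mulL.flip b = mulL.flip (mulL b c) := by
    apply hom_ext; intro U
    exact LinearMap.congr_fun (h2 U c) b
  exact LinearMap.congr_fun h3 a

theorem mulL_one (a : GrM F V) : mulL (y ⊥) a = a := by
  have : mulL (y (⊥ : Submodule F V)) = LinearMap.id := by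
    apply hom_ext; intro U; simp [mulL_y, yy]
  rw [this]; rfl

noncomputable instance : Mul (GrM F V) := ⟨fun a b => mulL a b⟩
noncomputable instance : One (GrM F V) := ⟨y ⊥⟩
theorem mul_def (a b : GrM F V) : a * b = mulL a b := rfl
theorem one_def : (1 : GrM F V) = y ⊥ := rfl

noncomputable instance : CommRing (GrM F V) :=
  { (inferInstance : AddCommGroup (GrM F V)) with
    mul := (· * ·)
    one := 1
    left_distrib := fun a b c => by simp [mul_def]
    right_distrib := fun a b c => by simp [mul_def]
    zero_mul := fun a => by simp [mul_def]
    mul_zero := fun a => by simp [mul_def]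
    mul_assoc := mulL_assoc
    one_mul := mulL_one
    mul_one := fun a => by rw [mul_def, mulL_comm]; exact mulL_one a
    mul_comm := mulL_comm }

noncomputable instance : Algebra ℝ (GrM F V) :=
  Algebra.ofModule (fun r x z => by simp [mul_def]) (fun r x z => by simp [mul_def])

theorem y_mul (U W : Submodule F V) : y U * y W = if Disjoint U W then y (U ⊔ W) else 0 := mulL_y U W

theorem y_mul_of_disj {U W : Submodule F V} (h : Disjoint U W) : y U * y W = y (U ⊔ W) := by
  rw [y_mul, if_pos h]
theorem y_mul_of_not {U W : Submodule F V} (h : ¬ Disjoint U W) : y U * y W = 0 := by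
  rw [y_mul, if_neg h]

theorem mul_eq_sum (a b : GrM F V) : a * b = ∑ U, ∑ W, (a U * b W) • (y U * y W) := by
  simp only [mul_def, mulL_y]; exact mulL_apply a b

/-- Homogeneous elements. -/
def Hom (k : ℕ) (a : GrM F V) : Prop := ∀ U, a U ≠ 0 → dm U = k

/-- Elements supported below `T`. -/
def RT (T : Submodule F V) (a : GrM F V) : Prop := ∀ U, a U ≠ 0 → U ≤ T

theorem dm_sup {U W : Submodule F V} (h : Disjoint U W) : dm (U ⊔ W) = dm U + dm W := by
  have := Submodule.finrank_sup_add_finrank_inf_eq U W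
  rw [h.eq_bot, finrank_bot] at this
  simpa using this

theorem Hom.mul {k l : ℕ} {a b : GrM F V} (ha : Hom k a) (hb : Hom l b) : Hom (k + l) (a * b) := by
  intro X hX
  rw [mul_eq_sum] at hX
  simp only [sum_app, smul_app] at hX
  obtain ⟨U, _, hU⟩ := Finset.exists_ne_zero_of_sum_ne_zero hX
  obtain ⟨W, _, hW⟩ := Finset.exists_ne_zero_of_sum_ne_zero hU
  have h1 : a U ≠ 0 := by rintro h; simp [h] at hW
  have h2 : b W ≠ 0 := by rintro h; simp [h] at hW
  by_cases hd : Disjoint U W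
  · rw [y_mul_of_disj hd, y_app] at hW
    have : X = U ⊔ W := by by_contra h; simp [h] at hW
    rw [this, dm_sup hd, ha U h1, hb W h2]
  · rw [y_mul_of_not hd] at hW; simp at hW

theorem RT.mul {T : Submodule F V} {a b : GrM F V} (ha : RT T a) (hb : RT T b) : RT T (a * b) := by
  intro X hX
  rw [mul_eq_sum] at hX
  simp only [sum_app, smul_app] at hX
  obtain ⟨U, _, hU⟩ := Finset.exists_ne_zero_of_sum_ne_zero hX
  obtain ⟨W, _, hW⟩ := Finset.exists_ne_zero_of_sum_ne_zero hU
  have h1 : a U ≠ 0 := by rintro h; simp [h] at hW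
  have h2 : b W ≠ 0 := by rintro h; simp [h] at hW
  by_cases hd : Disjoint U W
  · rw [y_mul_of_disj hd, y_app] at hW
    have : X = U ⊔ W := by by_contra h; simp [h] at hW
    rw [this]; exact sup_le (ha U h1) (hb W h2)
  · rw [y_mul_of_not hd] at hW; simp at hW

theorem Hom_y (U : Submodule F V) : Hom (dm U) (y U) := by
  intro X hX; rw [y_app] at hX
  have : X = U := by by_contra h; simp [h] at hX
  rw [this]
theorem RT_y {T U : Submodule F V} (h : U ≤ T) : RT T (y U) := by
  intro X hX; rw [y_app] at hX
  have : X = U := by by_contra h; simp [h] at hX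
  rw [this]; exact h
theorem Hom_one : Hom 0 (1 : GrM F V) := by
  have := Hom_y (⊥ : Submodule F V); simpa [dm, one_def] using this
theorem RT_one {T : Submodule F V} : RT T (1 : GrM F V) := RT_y bot_le
theorem Hom.pow {k : ℕ} {a : GrM F V} (ha : Hom k a) (n : ℕ) : Hom (n * k) (a ^ n) := by
  induction n with
  | zero => simpa using Hom_one
  | succ n ih => rw [pow_succ, add_mul, one_mul]; exact ih.mul ha
theorem RT.pow {T : Submodule F V} {a : GrM F V} (ha : RT T a) (n : ℕ) : RT T (a ^ n) := by
  induction n with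
  | zero => simpa using RT_one
  | succ n ih => rw [pow_succ]; exact ih.mul ha
theorem Hom_zero (k : ℕ) : Hom k (0 : GrM F V) := by intro U hU; simp at hU
theorem Hom.add {k : ℕ} {a b : GrM F V} (ha : Hom k a) (hb : Hom k b) : Hom k (a + b) := by
  intro U hU
  by_cases h : a U = 0
  · exact hb U (by simpa [h] using hU)
  · exact ha U h
theorem Hom.smul {k : ℕ} {a : GrM F V} (c : ℝ) (ha : Hom k a) : Hom k (c • a) := by
  intro U hU
  exact ha U (by rintro h; simp [h] at hU)
theorem Hom.sum {k : ℕ} {ι : Type*} {s : Finset ι} {f : ι → GrM F V} (h : ∀ i ∈ s, Hom k (f i)) :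
    Hom k (∑ i ∈ s, f i) := by
  intro U hU
  rw [sum_app] at hU
  obtain ⟨i, hi, hne⟩ := Finset.exists_ne_zero_of_sum_ne_zero hU
  exact h i hi U hne
theorem RT.add {k : Submodule F V} {a b : GrM F V} (ha : RT k a) (hb : RT k b) : RT k (a + b) := by
  intro U hU
  by_cases h : a U = 0
  · exact hb U (by simpa [h] using hU)
  · exact ha U h
theorem RT.smul {k : Submodule F V} {a : GrM F V} (c : ℝ) (ha : RT k a) : RT k (c • a) := by
  intro U hU
  exact ha U (by rintro h; simp [h] at hU)
theorem RT_zero (T : Submodule F V) : RT T (0 : GrM F V) := by intro U hU; simp at hU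
theorem RT.sum {k : Submodule F V} {ι : Type*} {s : Finset ι} {f : ι → GrM F V}
    (h : ∀ i ∈ s, RT k (f i)) : RT k (∑ i ∈ s, f i) := by
  intro U hU
  rw [sum_app] at hU
  obtain ⟨i, hi, hne⟩ := Finset.exists_ne_zero_of_sum_ne_zero hU
  exact h i hi U hne
theorem Hom.app_eq_zero {k : ℕ} {a : GrM F V} (ha : Hom k a) {T : Submodule F V} (h : dm T ≠ k) :
    a T = 0 := by by_contra h1; exact h (ha T h1)

/-- Projection to the degree `k` part. -/
noncomputable def pr (k : ℕ) : GrM F V →ₗ[ℝ] GrM F V where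
  toFun a := fun U => if dm U = k then a U else 0
  map_add' a b := by
    apply GrM.ext'; intro U
    change (if dm U = k then a U + b U else 0) = (if dm U = k then a U else 0) + (if dm U = k then b U else 0)
    split_ifs <;> simp
  map_smul' c a := by
    apply GrM.ext'; intro U
    change (if dm U = k then c * a U else 0) = c * (if dm U = k then a U else 0)
    split_ifs <;> simp

theorem pr_app (k : ℕ) (a : GrM F V) (U : Submodule F V) : pr k a U = if dm U = k then a U else 0 := rfl
theorem Hom_pr (k : ℕ) (a : GrM F V) : Hom k (pr k a) := by
  intro U hU; by_contra h; simp [pr_app, h] at hU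
theorem RT.pr {T : Submodule F V} {a : GrM F V} (h : RT T a) (k : ℕ) : RT T (pr k a) := by
  intro U hU; apply h; rintro h0; apply hU; simp [pr_app, h0]
theorem Hom.pr_eq {k : ℕ} {a : GrM F V} (ha : Hom k a) : pr k a = a := by
  apply GrM.ext'; intro U; rw [pr_app]; split_ifs with h
  · rfl
  · exact (ha.app_eq_zero h).symm
theorem Hom.pr_ne {k l : ℕ} {a : GrM F V} (ha : Hom k a) (h : l ≠ k) : pr l a = 0 := by
  apply GrM.ext'; intro U; rw [pr_app]; split_ifs with h1
  · rw [ha.app_eq_zero (by omega)]; rfl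
  · rfl
theorem sum_pr (a : GrM F V) : a = ∑ k ∈ Finset.range (Module.finrank F V + 1), pr k a := by
  apply GrM.ext'; intro U
  have : dm U < Module.finrank F V + 1 := Nat.lt_succ_of_le (Submodule.finrank_le U)
  simp only [sum_app, pr_app]
  rw [Finset.sum_ite_eq]; simp [this]
theorem pr_mul {l : ℕ} {x : GrM F V} (hx : Hom l x) (k : ℕ) (a : GrM F V) :
    pr (l + k) (x * a) = x * pr k a := by
  conv_lhs => rw [sum_pr a, Finset.mul_sum, map_sum]
  by_cases hk : k ∈ Finset.range (Module.finrank F V + 1)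
  · rw [Finset.sum_eq_single k]
    · exact (hx.mul (Hom_pr k a)).pr_eq
    · intro b _ hb; exact (hx.mul (Hom_pr b a)).pr_ne (by omega)
    · intro h; exact absurd hk h
  · rw [Finset.sum_eq_zero]
    · have : pr k a = 0 := by
        apply GrM.ext'; intro U
        have : dm U < Module.finrank F V + 1 := Nat.lt_succ_of_le (Submodule.finrank_le U)
        rw [pr_app, if_neg]; · rfl
        rintro rfl; exact hk (by simpa using this)
      rw [this, mul_zero]
    · intro b hb; exact (hx.mul (Hom_pr b a)).pr_ne (by rintro h; exact hk (by simpa [show k = b by omega] using hb))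
theorem pr_mul_lt {l : ℕ} {x : GrM F V} (hx : Hom l x) {k : ℕ} (hk : k < l) (a : GrM F V) :
    pr k (x * a) = 0 := by
  conv_lhs => rw [sum_pr a, Finset.mul_sum, map_sum]
  rw [Finset.sum_eq_zero]
  intro b _; exact (hx.mul (Hom_pr b a)).pr_ne (by omega)

theorem Hom_zero_eq {a : GrM F V} (h : Hom 0 a) : a = a ⊥ • (1 : GrM F V) := by
  apply GrM.ext'; intro U
  rw [smul_app, one_def, y_app]
  split_ifs with hU
  · rw [hU, mul_one]
  · rw [mul_zero]; apply h.app_eq_zero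
    intro h0; exact hU (Submodule.finrank_eq_zero.mp h0)
end Ring
end HW


namespace HW
open Classical
set_option linter.unusedSectionVars false

section Basic
variable {F V : Type*} [Field F] [AddCommGroup V] [Module F V] [Finite V]

/-- The line spanned by a vector. -/
abbrev ln (v : V) : Submodule F V := Submodule.span F {v}

/-- The degree one generator attached to a vector. -/
noncomputable def yv (F : Type*) {V : Type*} [Field F] [AddCommGroup V] [Module F V] [Finite V]
    (v : V) : GrM F V := y (ln v)

theorem disj_ln {v : V} {U : Submodule F V} (h : v ∉ U) : Disjoint (ln v : Submodule F V) U := by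
  have h0 : v ≠ 0 := by rintro rfl; exact h U.zero_mem
  rw [disjoint_comm, Submodule.disjoint_span_singleton' h0]; exact h

theorem yv_mul_mem {v : V} {U : Submodule F V} (h0 : v ≠ 0) (h : v ∈ U) : yv F v * y U = 0 := by
  apply y_mul_of_not
  intro hd
  exact h0 ((Submodule.disjoint_def.mp hd) v (Submodule.mem_span_singleton_self v) h)

theorem yv_mul_not {v : V} {U : Submodule F V} (h : v ∉ U) : yv F v * y U = y (U ⊔ ln v) := by
  rw [yv, y_mul_of_disj (disj_ln h), sup_comm]

theorem dm_ln {v : V} (h : v ≠ 0) : dm (ln v : Submodule F V) = 1 := finrank_span_singleton h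

theorem dm_sup_ln {v : V} {U : Submodule F V} (h : v ∉ U) : dm (U ⊔ ln v) = dm U + 1 := by
  have h0 : v ≠ 0 := by rintro rfl; exact h U.zero_mem
  rw [dm_sup (disj_ln h).symm, dm_ln h0]

theorem Hom_yv {v : V} (h : v ≠ 0) : Hom 1 (yv F v) := by
  have := Hom_y (ln v : Submodule F V)
  rwa [dm_ln h] at this

theorem ln_le {v : V} {T : Submodule F V} (h : v ∈ T) : ln v ≤ T := by
  rw [Submodule.span_le]; simpa using h

theorem RT_yv {v : V} {T : Submodule F V} (h : v ∈ T) : RT T (yv F v) := RT_y (ln_le h)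

/-- Spanned by elements of `E`. -/
def Fl (E : Finset V) (U : Submodule F V) : Prop := Submodule.span F {v | v ∈ E ∧ v ∈ U} = U

theorem Fl.sup {E : Finset V} {U : Submodule F V} (h : Fl E U) {v : V} (hv : v ∈ E) :
    Fl E (U ⊔ ln v) := by
  apply le_antisymm
  · rw [Submodule.span_le]; rintro x ⟨_, hx⟩; exact hx
  · apply sup_le
    · conv_lhs => rw [← h]
      apply Submodule.span_mono
      rintro x ⟨h1, h2⟩; exact ⟨h1, le_sup_left (a := U) h2⟩
    · apply Submodule.span_mono
      rintro x rfl
      exact ⟨hv, le_sup_right (a := U) (Submodule.mem_span_singleton_self _)⟩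

theorem Fl.mono {E E' : Finset V} (hE : E ⊆ E') {U : Submodule F V} (h : Fl E U) : Fl E' U := by
  apply le_antisymm
  · rw [Submodule.span_le]; rintro x ⟨_, hx⟩; exact hx
  · conv_lhs => rw [← h]
    apply Submodule.span_mono
    rintro x ⟨h1, h2⟩; exact ⟨hE h1, h2⟩

theorem Fl_bot (E : Finset V) : Fl E (⊥ : Submodule F V) := by
  apply le_antisymm
  · rw [Submodule.span_le]; rintro x ⟨_, hx⟩; exact hx
  · exact bot_le

theorem Fl_span (E : Finset V) : Fl E (Submodule.span F (E : Set V)) := by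
  apply le_antisymm
  · rw [Submodule.span_le]; rintro x ⟨_, hx⟩; exact hx
  · apply Submodule.span_mono
    intro x hx; exact ⟨hx, Submodule.subset_span hx⟩

/-- Admissible configuration: nonzero vectors spanning `T`. -/
structure Adm (T : Submodule F V) (E : Finset V) : Prop where
  ne : ∀ v ∈ E, v ≠ 0
  span : Submodule.span F (E : Set V) = T

theorem Adm.mem {T : Submodule F V} {E : Finset V} (h : Adm T E) {v : V} (hv : v ∈ E) : v ∈ T := by
  rw [← h.span]; exact Submodule.subset_span hv

theorem Fl.le {T : Submodule F V} {E : Finset V} (hA : Adm T E) {U : Submodule F V} (h : Fl E U) :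
    U ≤ T := by
  rw [← h, Submodule.span_le]; rintro x ⟨hx, _⟩; exact hA.mem hx

/-- If `U` is not `T` some vector of `E` is outside. -/
theorem Adm.exists_not_mem {T : Submodule F V} {E : Finset V} (hA : Adm T E) {U : Submodule F V}
    (hU : ¬ T ≤ U) : ∃ v ∈ E, v ∉ U := by
  by_contra! h
  apply hU; rw [← hA.span, Submodule.span_le]; exact h

/-- The Lefschetz element with unit weights. -/
noncomputable def LE (F : Type*) {V : Type*} [Field F] [AddCommGroup V] [Module F V] [Finite V]
    (E : Finset V) : GrM F V := ∑ v ∈ E, yv F v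

/-- The basic module structure. -/
structure Pre (T : Submodule F V) (E : Finset V) (N : Submodule ℝ (GrM F V)) : Prop where
  rt : ∀ a ∈ N, RT T a
  gr : ∀ a ∈ N, ∀ k, pr k a ∈ N
  one : (1 : GrM F V) ∈ N
  mul : ∀ v ∈ E, ∀ a ∈ N, yv F v * a ∈ N
  pd : ∀ a ∈ N, (∀ b ∈ N, (a * b) T = 0) → a = 0

def HR (T U : Submodule F V) (N : Submodule ℝ (GrM F V)) (L : GrM F V) : Prop :=
  ∀ k : ℕ, ∀ a ∈ N, Hom k a → 2 * k ≤ dm T - dm U →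
    y U * L ^ (dm T - dm U - 2 * k + 1) * a = 0 → y U * a ≠ 0 →
    0 < (-1 : ℝ) ^ k * (y U * L ^ (dm T - dm U - 2 * k) * a * a) T

def HL (T U : Submodule F V) (N : Submodule ℝ (GrM F V)) (L : GrM F V) : Prop :=
  ∀ k : ℕ, ∀ a ∈ N, Hom k a → 2 * k ≤ dm T - dm U →
    y U * L ^ (dm T - dm U - 2 * k) * a = 0 → y U * a = 0

theorem HR.toHL {T U : Submodule F V} {N : Submodule ℝ (GrM F V)} {L : GrM F V} (h : HR T U N L) :
    HL T U N L := by
  intro k a ha hk h2 h0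
  by_contra hne
  have := h k a ha hk h2 (by rw [pow_succ, show y U * (L ^ (dm T - dm U - 2 * k) * L) * a =
    L * (y U * L ^ (dm T - dm U - 2 * k) * a) by ring, h0, mul_zero]) hne
  rw [h0, zero_mul, zero_app, mul_zero] at this
  exact lt_irrefl _ this

structure Good (T : Submodule F V) (E : Finset V) (N : Submodule ℝ (GrM F V)) : Prop extends
    Pre T E N where
  hr : ∀ U, Fl E U → HR T U N (LE F E)
  ns : ∀ U, Fl E U → U ≠ T → ∀ k : ℕ, 2 * k ≤ dm T - dm U → ∀ a ∈ N, Hom k a →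
    (∀ v ∈ E, yv F v * y U * a = 0) → y U * a = 0
  cf : ∀ U, Fl E U → ∀ a ∈ N, (∀ v ∈ E, yv F v * y U * a = 0) →
    ∃ a' ∈ N, y U * a' = y U * a ∧ ∀ v ∈ E, v ∉ U → yv F v * a' = 0
  mn : ∀ N1, N1 ≤ N → Pre T E N1 → N1 = N

theorem Pre.y_mem_span {T : Submodule F V} {E : Finset V} {N : Submodule ℝ (GrM F V)}
    (h : Pre T E N) (S : Finset V) (hS : S ⊆ E) :
    ∀ a ∈ N, y (Submodule.span F (S : Set V)) * a ∈ N := by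
  induction S using Finset.induction_on with
  | empty => intro a ha; simpa [← one_def] using ha
  | insert v S hv ih =>
    intro a ha
    have hS' : S ⊆ E := fun x hx => hS (Finset.mem_insert_of_mem hx)
    rw [Finset.coe_insert, Submodule.span_insert]
    by_cases hm : v ∈ Submodule.span F (S : Set V)
    · rw [sup_eq_right.mpr (ln_le hm)]; exact ih hS' a ha
    · rw [sup_comm, ← yv_mul_not hm, mul_assoc]
      exact h.mul v (hS (Finset.mem_insert_self _ _)) _ (ih hS' a ha)

theorem Pre.y_mem {T : Submodule F V} {E : Finset V} {N : Submodule ℝ (GrM F V)}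
    (h : Pre T E N) {U : Submodule F V} (hU : Fl E U) : ∀ a ∈ N, y U * a ∈ N := by
  have := h.y_mem_span (E.filter (· ∈ U)) (Finset.filter_subset _ _)
  have h2 : Submodule.span F ((E.filter (· ∈ U) : Finset V) : Set V) = U := by
    conv_rhs => rw [← hU]
    congr 1; ext x; simp
  rwa [h2] at this

theorem mul_app_pr {k : ℕ} {x : GrM F V} (hx : Hom k x) {T : Submodule F V} (hk : k ≤ dm T)
    (b : GrM F V) : (x * b) T = (x * pr (dm T - k) b) T := by
  have := pr_mul hx (dm T - k) b
  rw [← this, show k + (dm T - k) = dm T by omega, pr_app, if_pos rfl]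

theorem mul_app_gt {k : ℕ} {x : GrM F V} (hx : Hom k x) {T : Submodule F V} (hk : dm T < k)
    (b : GrM F V) : (x * b) T = 0 := by
  have := pr_mul_lt hx hk b
  have h2 : pr (dm T) (x * b) T = 0 := by rw [this]; rfl
  rwa [pr_app, if_pos rfl] at h2

/-- Homogeneous Poincaré duality. -/
theorem Pre.pdh {T : Submodule F V} {E : Finset V} {N : Submodule ℝ (GrM F V)}
    (h : Pre T E N) {k l : ℕ} (hkl : k + l = dm T) {a : GrM F V} (ha : a ∈ N) (hk : Hom k a)
    (h0 : ∀ b ∈ N, Hom l b → (a * b) T = 0) : a = 0 := by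
  apply h.pd a ha
  intro b hb
  rw [mul_app_pr hk (by omega)]
  exact h0 _ (h.gr b hb _) (by rw [show dm T - k = l by omega]; exact Hom_pr _ _)

theorem Pre.zero_of_gt {T : Submodule F V} {E : Finset V} {N : Submodule ℝ (GrM F V)}
    (h : Pre T E N) {k : ℕ} (hk : dm T < k) {a : GrM F V} (ha : a ∈ N) (hh : Hom k a) : a = 0 :=
  h.pd a ha (fun b _ => mul_app_gt hh hk b)

/-- Acting on a submodule. -/
def Act (N : Submodule ℝ (GrM F V)) (x : GrM F V) : Prop := ∀ a ∈ N, x * a ∈ N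

theorem Act.mul {N : Submodule ℝ (GrM F V)} {x z : GrM F V} (hx : Act N x) (hz : Act N z) :
    Act N (x * z) := fun a ha => by rw [mul_assoc]; exact hx _ (hz a ha)
theorem Act.pow {N : Submodule ℝ (GrM F V)} {x : GrM F V} (hx : Act N x) (n : ℕ) :
    Act N (x ^ n) := by
  induction n with
  | zero => intro a ha; simpa using ha
  | succ n ih => rw [pow_succ]; exact ih.mul hx
theorem Act.add {N : Submodule ℝ (GrM F V)} {x z : GrM F V} (hx : Act N x) (hz : Act N z) :
    Act N (x + z) := fun a ha => by rw [add_mul]; exact N.add_mem (hx _ ha) (hz a ha)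
theorem Act.smul {N : Submodule ℝ (GrM F V)} {x : GrM F V} (hx : Act N x) (c : ℝ) :
    Act N (c • x) := fun a ha => by rw [smul_mul_assoc]; exact N.smul_mem _ (hx _ ha)
theorem Act.sum {N : Submodule ℝ (GrM F V)} {ι : Type*} {s : Finset ι} {f : ι → GrM F V}
    (h : ∀ i ∈ s, Act N (f i)) : Act N (∑ i ∈ s, f i) := fun a ha => by
  rw [Finset.sum_mul]; exact N.sum_mem (fun i hi => h i hi a ha)

theorem Pre.act_LE {T : Submodule F V} {E : Finset V} {N : Submodule ℝ (GrM F V)}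
    (h : Pre T E N) : Act N (LE F E) := Act.sum (fun v hv => h.mul v hv)

theorem Hom_LE {E : Finset V} (h : ∀ v ∈ E, v ≠ 0) : Hom 1 (LE F E) :=
  Hom.sum (fun v hv => Hom_yv (h v hv))

theorem dm_mono {U T : Submodule F V} (h : U ≤ T) : dm U ≤ dm T := Submodule.finrank_mono h
theorem eq_of_dm {U T : Submodule F V} (h : U ≤ T) (hd : dm T ≤ dm U) : U = T :=
  Submodule.eq_of_le_of_finrank_le h hd

/-- Choice of representatives of a basis of the image. -/
theorem exists_lifts (D : Submodule ℝ (GrM F V)) (f : GrM F V →ₗ[ℝ] GrM F V) :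
    ∃ (n : ℕ) (a : Fin n → GrM F V), (∀ i, a i ∈ D) ∧ LinearIndependent ℝ (fun i => f (a i)) ∧
      ∀ d ∈ D, ∃ x : Fin n → ℝ, f d = f (∑ i, x i • a i) := by
  let b := Module.finBasis ℝ (D.map f)
  have h : ∀ i, ∃ a ∈ D, f a = b i := fun i => by
    obtain ⟨a, ha, h⟩ := (b i).2; exact ⟨a, ha, h⟩
  choose a ha hab using h
  refine ⟨_, a, ha, ?_, ?_⟩
  · simp only [hab]
    exact b.linearIndependent.map' (D.map f).subtype (Submodule.ker_subtype _)
  · intro d hd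
    refine ⟨fun i => b.repr ⟨f d, d, hd, rfl⟩ i, ?_⟩
    rw [map_sum]; simp only [map_smul, hab]
    have := congrArg (D.map f).subtype (b.sum_repr ⟨f d, d, hd, rfl⟩)
    simp only [map_sum, map_smul, Submodule.subtype_apply] at this
    exact this.symm

end Basic
end HW


namespace HW
open Classical Matrix

section Cont
variable {ι κ : Type*} [Fintype ι] [Fintype κ]

theorem cont_quad (A : ℝ → Matrix κ κ ℝ) (hA : Continuous A) :
    Continuous (fun p : ℝ × (κ → ℝ) => p.2 ⬝ᵥ (A p.1 *ᵥ p.2)) := by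
  apply Continuous.dotProduct continuous_snd
  exact (hA.comp continuous_fst).matrix_mulVec continuous_snd

theorem exists_sigma (A : ℝ → Matrix κ κ ℝ) (hA : Continuous A)
    (hn : ∀ t ∈ Set.Icc (0:ℝ) 1, ∀ u, A t *ᵥ u = 0 → u = 0) :
    ∃ σ : ℝ, 0 ≤ σ ∧ ∀ t ∈ Set.Icc (0:ℝ) 1, ∀ u, u ≠ 0 →
      0 < u ⬝ᵥ (A t *ᵥ u) + σ * ((A t *ᵥ u) ⬝ᵥ (A t *ᵥ u)) := by
  have hpos : ∀ t ∈ Set.Icc (0:ℝ) 1, ∀ u, u ≠ 0 → 0 < (A t *ᵥ u) ⬝ᵥ (A t *ᵥ u) := by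
    intro t ht u hu
    have h1 : A t *ᵥ u ≠ 0 := fun h => hu (hn t ht u h)
    have h2 : 0 ≤ (A t *ᵥ u) ⬝ᵥ (A t *ᵥ u) := Finset.sum_nonneg (fun i _ => mul_self_nonneg _)
    exact lt_of_le_of_ne h2 (fun h => h1 (dotProduct_self_eq_zero.mp h.symm))
  have hK : IsCompact ((Set.Icc (0:ℝ) 1) ×ˢ (Metric.sphere (0 : κ → ℝ) 1)) :=
    isCompact_Icc.prod (isCompact_sphere _ _)
  have hc : ContinuousOn (fun p : ℝ × (κ → ℝ) => (p.2 ⬝ᵥ (A p.1 *ᵥ p.2)) /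
      ((A p.1 *ᵥ p.2) ⬝ᵥ (A p.1 *ᵥ p.2))) ((Set.Icc (0:ℝ) 1) ×ˢ (Metric.sphere (0 : κ → ℝ) 1)) := by
    apply ContinuousOn.div
    · exact (cont_quad A hA).continuousOn
    · have h := (hA.comp continuous_fst).matrix_mulVec (continuous_snd (X := ℝ) (Y := κ → ℝ))
      exact (Continuous.dotProduct h h).continuousOn
    · rintro ⟨t, u⟩ ⟨h1, h2⟩
      have : u ≠ 0 := by rintro rfl; simp at h2
      exact (hpos t h1 u this).ne'
  obtain ⟨C, hC⟩ := hK.exists_bound_of_continuousOn hc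
  refine ⟨|C| + 1, by positivity, ?_⟩
  intro t ht u hu
  have hnu : 0 < ‖u‖ := norm_pos_iff.mpr hu
  have key : ∀ w : κ → ℝ, ‖w‖ = 1 → 0 < w ⬝ᵥ (A t *ᵥ w) + (|C| + 1) * ((A t *ᵥ w) ⬝ᵥ (A t *ᵥ w)) := by
    intro w hw
    have hw0 : w ≠ 0 := by rintro rfl; simp at hw
    have h1 := hC (t, w) ⟨ht, by simpa using hw⟩
    have h2 := hpos t ht w hw0
    simp only [Real.norm_eq_abs] at h1
    have h3 := (abs_le.mp h1).1
    have h4 := le_abs_self C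
    have h5 : -(|C|) ≤ (w ⬝ᵥ (A t *ᵥ w)) / ((A t *ᵥ w) ⬝ᵥ (A t *ᵥ w)) := by linarith
    rw [le_div_iff₀ h2] at h5
    nlinarith
  have h := key (‖u‖⁻¹ • u) (by rw [norm_smul, norm_inv, norm_norm, inv_mul_cancel₀ hnu.ne'])
  simp only [mulVec_smul, smul_dotProduct, dotProduct_smul, smul_eq_mul] at h
  have h6 : 0 < ‖u‖⁻¹ * ‖u‖⁻¹ := by positivity
  have : ‖u‖⁻¹ * (‖u‖⁻¹ * u ⬝ᵥ A t *ᵥ u) + (|C| + 1) * (‖u‖⁻¹ * (‖u‖⁻¹ * A t *ᵥ u ⬝ᵥ A t *ᵥ u)) =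
    (‖u‖⁻¹ * ‖u‖⁻¹) * (u ⬝ᵥ A t *ᵥ u + (|C| + 1) * (A t *ᵥ u ⬝ᵥ A t *ᵥ u)) := by ring
  rw [this] at h
  exact (mul_pos_iff_of_pos_left h6).mp h

theorem path_pd (S : ℝ → Matrix ι ι ℝ) (hS : Continuous S) (hsym : ∀ t, (S t)ᵀ = S t)
    (hn : ∀ t ∈ Set.Icc (0:ℝ) 1, ∀ u, S t *ᵥ u = 0 → u = 0)
    (h1 : ∀ u, u ≠ 0 → 0 < u ⬝ᵥ (S 1 *ᵥ u)) :
    ∀ t ∈ Set.Icc (0:ℝ) 1, ∀ u, u ≠ 0 → 0 < u ⬝ᵥ (S t *ᵥ u) := by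
  by_contra! hcon
  obtain ⟨t0, ht0, u0, hu0, hle⟩ := hcon
  let K : Set (ℝ × (ι → ℝ)) := ((Set.Icc (0:ℝ) 1) ×ˢ (Metric.sphere (0 : ι → ℝ) 1)) ∩
    {p | p.2 ⬝ᵥ (S p.1 *ᵥ p.2) ≤ 0}
  have hK : IsCompact K := (isCompact_Icc.prod (isCompact_sphere _ _)).inter_right
    (isClosed_le (cont_quad S hS) continuous_const)
  have mk : ∀ t ∈ Set.Icc (0:ℝ) 1, ∀ u, u ≠ 0 → u ⬝ᵥ (S t *ᵥ u) ≤ 0 → t ∈ Prod.fst '' K := by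
    intro t ht u hu h
    have hnu : 0 < ‖u‖ := norm_pos_iff.mpr hu
    refine ⟨(t, ‖u‖⁻¹ • u), ⟨⟨ht, ?_⟩, ?_⟩, rfl⟩
    · simp [norm_smul, hnu.ne']
    · simp only [Set.mem_ofPred_eq, mulVec_smul, smul_dotProduct, dotProduct_smul, smul_eq_mul]
      have h6 : 0 < ‖u‖⁻¹ * ‖u‖⁻¹ := by positivity
      rw [← mul_assoc]
      exact mul_nonpos_of_nonneg_of_nonpos h6.le h
  have hKi : IsCompact (Prod.fst '' K) := hK.image continuous_fst
  obtain ⟨ts, ⟨⟨⟨t, u⟩, ⟨⟨hts, hus⟩, hu⟩, rfl⟩, hmax⟩⟩ := hKi.exists_isGreatest ⟨t0, mk t0 ht0 u0 hu0 hle⟩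
  simp only at hts hus hu hmax
  have hune : u ≠ 0 := by rintro rfl; simp at hus
  have hlt : t < 1 := by
    rcases lt_or_eq_of_le hts.2 with h | h
    · exact h
    · subst h; exact absurd (h1 u hune) (not_lt.mpr hu)
  have hpsd : ∀ w, 0 ≤ w ⬝ᵥ (S t *ᵥ w) := by
    intro w
    by_cases hw : w = 0
    · simp [hw]
    have hcw : Continuous (fun s : ℝ => w ⬝ᵥ (S s *ᵥ w)) :=
      (cont_quad S hS).comp (continuous_id.prodMk continuous_const)
    have : Filter.Tendsto (fun s : ℝ => w ⬝ᵥ (S s *ᵥ w)) (nhdsWithin t (Set.Ioi t))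
        (nhds (w ⬝ᵥ (S t *ᵥ w))) := (hcw.tendsto t).mono_left nhdsWithin_le_nhds
    apply ge_of_tendsto this
    filter_upwards [Ioo_mem_nhdsGT hlt] with s hs
    by_contra! hneg
    have := hmax (mk s ⟨hts.1.trans hs.1.le, hs.2.le⟩ w hw hneg.le)
    linarith [hs.1]
  have hPS : (S t).PosSemidef := by
    refine Matrix.PosSemidef.of_dotProduct_mulVec_nonneg ?_ ?_
    · rw [Matrix.IsHermitian, conjTranspose_eq_transpose_of_trivial]; exact hsym t
    · intro x; simpa using hpsd x
  have hz : u ⬝ᵥ (S t *ᵥ u) = 0 := le_antisymm hu (hpsd u)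
  have := (hPS.dotProduct_mulVec_zero_iff u).mp (by simpa using hz)
  exact hune (hn t hts u this)

theorem cont_lemma (A : ℝ → Matrix κ κ ℝ) (B : ℝ → Matrix ι ι ℝ) (C : ℝ → Matrix κ ι ℝ)
    (hA : Continuous A) (hB : Continuous B) (hC : Continuous C)
    (hAs : ∀ t, (A t)ᵀ = A t) (hBs : ∀ t, (B t)ᵀ = B t)
    (hl : ∀ t, ∃ l : Matrix ι κ ℝ, C t = lᵀ * B t ∧ A t = C t * l)
    (hAn : ∀ t ∈ Set.Icc (0:ℝ) 1, ∀ u, A t *ᵥ u = 0 → u = 0)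
    (hBn : ∀ t ∈ Set.Icc (0:ℝ) 1, ∀ u, B t *ᵥ u = 0 → u = 0)
    (h1 : ∀ w, w ≠ 0 → C 1 *ᵥ w = 0 → 0 < w ⬝ᵥ (B 1 *ᵥ w)) :
    ∀ t ∈ Set.Icc (0:ℝ) 1, ∀ w, w ≠ 0 → C t *ᵥ w = 0 → 0 < w ⬝ᵥ (B t *ᵥ w) := by
  obtain ⟨σ, hσ0, hσ⟩ := exists_sigma A hA hAn
  have hq : ∀ t w, w ⬝ᵥ ((B t + σ • ((C t)ᵀ * C t)) *ᵥ w) =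
      w ⬝ᵥ (B t *ᵥ w) + σ * ((C t *ᵥ w) ⬝ᵥ (C t *ᵥ w)) := by
    intro t w
    rw [add_mulVec, dotProduct_add, smul_mulVec, dotProduct_smul, smul_eq_mul,
      ← mulVec_mulVec, dotProduct_mulVec w (C t)ᵀ, vecMul_transpose]
  have key := path_pd (fun t => B t + σ • ((C t)ᵀ * C t)) ?_ ?_ ?_ ?_
  · intro t ht w hw hCw
    have := key t ht w hw
    rw [hq, hCw] at this
    simpa using this
  · exact hB.add ((hC.matrix_transpose.matrix_mul hC).const_smul σ)
  · intro t
    simp [transpose_add, transpose_smul, transpose_mul, hBs]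
  · intro t ht w hw
    obtain ⟨l, hl1, hl2⟩ := hl t
    have e1 : lᵀ *ᵥ ((B t + σ • ((C t)ᵀ * C t)) *ᵥ w) = C t *ᵥ w + σ • (A t *ᵥ (C t *ᵥ w)) := by
      rw [add_mulVec, mulVec_add, mulVec_mulVec, ← hl1, smul_mulVec, mulVec_smul]
      congr 2
      rw [← mulVec_mulVec, mulVec_mulVec, ← hAs t, hl2, transpose_mul]
    rw [hw, mulVec_zero] at e1
    have hx : C t *ᵥ w = 0 := by
      by_contra hne
      have h2 := hσ t ht _ hne
      have e2 : C t *ᵥ w = - (σ • (A t *ᵥ (C t *ᵥ w))) := eq_neg_of_add_eq_zero_left e1.symm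
      have e3 : (C t *ᵥ w) ⬝ᵥ (A t *ᵥ (C t *ᵥ w)) =
        - (σ • (A t *ᵥ (C t *ᵥ w))) ⬝ᵥ (A t *ᵥ (C t *ᵥ w)) := congrArg (· ⬝ᵥ (A t *ᵥ (C t *ᵥ w))) e2
      rw [neg_dotProduct, smul_dotProduct, smul_eq_mul] at e3
      linarith
    apply hBn t ht
    rw [add_mulVec, smul_mulVec, ← mulVec_mulVec, hx, mulVec_zero, smul_zero, add_zero] at hw
    exact hw
  · intro w hw
    rw [hq]
    obtain ⟨l, hl1, hl2⟩ := hl 1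
    have hmem : (1:ℝ) ∈ Set.Icc (0:ℝ) 1 := by simp
    have hinj : Function.Injective (A 1).mulVecLin := by
      rw [← LinearMap.ker_eq_bot, LinearMap.ker_eq_bot']
      intro u hu; exact hAn 1 hmem u hu
    obtain ⟨u, hu⟩ := (LinearMap.injective_iff_surjective.mp hinj) (C 1 *ᵥ w)
    rw [mulVecLin_apply] at hu
    obtain ⟨w0, hw0⟩ : ∃ w0, w0 = w - l *ᵥ u := ⟨_, rfl⟩
    have hCw0 : C 1 *ᵥ w0 = 0 := by
      rw [hw0, mulVec_sub, mulVec_mulVec, ← hl2, hu, sub_self]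
    have hw' : w = w0 + l *ᵥ u := by rw [hw0]; abel
    have hBl : ∀ z, (l *ᵥ u) ⬝ᵥ (B 1 *ᵥ z) = u ⬝ᵥ (C 1 *ᵥ z) := by
      intro z
      rw [hl1, ← mulVec_mulVec, dotProduct_mulVec u, vecMul_transpose]
    have hsw : ∀ x z, x ⬝ᵥ (B 1 *ᵥ z) = z ⬝ᵥ (B 1 *ᵥ x) := by
      intro x z
      rw [dotProduct_mulVec, ← mulVec_transpose, hBs, dotProduct_comm]
    have e : w ⬝ᵥ (B 1 *ᵥ w) = w0 ⬝ᵥ (B 1 *ᵥ w0) + u ⬝ᵥ (A 1 *ᵥ u) := by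
      rw [hw', add_dotProduct, hBl, mulVec_add, mulVec_add, dotProduct_add, dotProduct_add, hCw0,
        hsw w0 (l *ᵥ u), hBl, hCw0, mulVec_mulVec]
      rw [← hl2]; simp
    rw [e, ← hu]
    by_cases hu0 : u = 0
    · have : w0 = w := by rw [hw0, hu0]; simp
      have h3 := h1 w0 (by rw [this]; exact hw) hCw0
      simpa [hu0] using h3
    · have h4 := hσ 1 hmem u hu0
      by_cases hz : w0 = 0
      · rw [hz]; simpa using h4
      · have := h1 w0 hz hCw0
        linarith
end Cont
end HW


namespace HW
open Classical Matrix
set_option linter.unusedSectionVars false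

section ContHR
variable {F V : Type*} [Field F] [AddCommGroup V] [Module F V] [Finite V]

theorem app_congr {a b : GrM F V} {T : Submodule F V} (h : a = b) : a T = b T := by rw [h]
theorem mapp_congr {a b : GrM F V} {T : Submodule F V} {c : ℝ} (h : a = b) :
    c * a T = c * b T := by rw [h]

theorem cont_pow (T : Submodule F V) (L0 L1 : GrM F V) (j : ℕ) :
    ∀ x : GrM F V, Continuous (fun t : ℝ => (x * (L0 + t • L1) ^ j) T) := by
  induction j with
  | zero => intro x; simp only [pow_zero]; exact continuous_const
  | succ j ih =>
    intro x
    have : (fun t : ℝ => (x * (L0 + t • L1) ^ (j + 1)) T) =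
        fun t : ℝ => ((x * L0) * (L0 + t • L1) ^ j) T + t * ((x * L1) * (L0 + t • L1) ^ j) T := by
      funext t
      rw [← smul_app, ← add_app]; apply app_congr
      rw [pow_succ, ← smul_mul_assoc, ← add_mul, ← mul_smul_comm, ← mul_add]; ring
    rw [this]
    exact (ih _).add (continuous_id.mul (ih _))

theorem mv_lemma {ι κ : Type*} [Fintype κ] (T : Submodule F V) (c : ℝ) (z : GrM F V)
    (p : ι → GrM F V) (q : κ → GrM F V) (x : κ → ℝ) :
    (Matrix.of fun i j => c * (z * p i * q j) T) *ᵥ x =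
      fun i => c * (z * p i * (∑ j, x j • q j)) T := by
  funext i
  simp only [mulVec, dotProduct, of_apply, Finset.mul_sum, sum_app, mul_smul_comm, smul_app]
  apply Finset.sum_congr rfl; intro j _; ring

theorem dot_lemma {ι : Type*} [Fintype ι] (T : Submodule F V) (c : ℝ) (z b : GrM F V)
    (p : ι → GrM F V) (w : ι → ℝ) :
    w ⬝ᵥ (fun i => c * (z * p i * b) T) = c * (z * (∑ i, w i • p i) * b) T := by
  simp only [dotProduct, Finset.mul_sum, Finset.sum_mul, sum_app, mul_smul_comm, smul_mul_assoc,
    smul_app]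
  apply Finset.sum_congr rfl; intro j _; ring

/-- Homogeneous part of a submodule. -/
def Nk (N : Submodule ℝ (GrM F V)) (k : ℕ) : Submodule ℝ (GrM F V) where
  carrier := {a | a ∈ N ∧ Hom k a}
  add_mem' := fun ha hb => ⟨N.add_mem ha.1 hb.1, ha.2.add hb.2⟩
  zero_mem' := ⟨N.zero_mem, Hom_zero k⟩
  smul_mem' := fun c _ ha => ⟨N.smul_mem c ha.1, ha.2.smul c⟩

theorem mem_Nk {N : Submodule ℝ (GrM F V)} {k : ℕ} {a : GrM F V} :
    a ∈ Nk N k ↔ a ∈ N ∧ Hom k a := Iff.rfl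

/-- Previous homogeneous part. -/
noncomputable def Np (N : Submodule ℝ (GrM F V)) : ℕ → Submodule ℝ (GrM F V)
  | 0 => ⊥
  | k + 1 => Nk N k

theorem Hom_yLa {U : Submodule F V} {L a : GrM F V} {k : ℕ} (hL : Hom 1 L) (ha : Hom k a) (j : ℕ) :
    Hom (dm U + j + k) (y U * L ^ j * a) := by
  have := ((Hom_y U).mul (hL.pow j)).mul ha
  simpa using this

theorem contHR {T U : Submodule F V} {E : Finset V} {N : Submodule ℝ (GrM F V)}
    (hP : Pre T E N) (hUT : U ≤ T) (hUa : Act N (y U)) {L0 L1 : GrM F V}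
    (hL : ∀ t : ℝ, Hom 1 (L0 + t • L1)) (hact : ∀ t : ℝ, Act N (L0 + t • L1))
    (hHL : ∀ t ∈ Set.Icc (0:ℝ) 1, HL T U N (L0 + t • L1))
    (hHR : HR T U N (L0 + (1:ℝ) • L1)) :
    ∀ t ∈ Set.Icc (0:ℝ) 1, HR T U N (L0 + t • L1) := by
  intro t ht k a ha hka hkm hprim hne
  have hdU : dm U ≤ dm T := dm_mono hUT
  obtain ⟨m, hm⟩ : ∃ m, dm T - dm U = m := ⟨_, rfl⟩
  rw [hm] at hkm hprim ⊢
  obtain ⟨j, hj⟩ : ∃ j, m - 2 * k = j := ⟨_, rfl⟩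
  rw [hj] at hprim ⊢
  -- the three duality statements
  have P0 : ∀ t ∈ Set.Icc (0:ℝ) 1, ∀ w ∈ Nk N k,
      (∀ b ∈ Nk N k, (y U * (L0 + t • L1) ^ j * w * b) T = 0) → y U * w = 0 := by
    intro t ht w hw h
    have h1 : y U * (L0 + t • L1) ^ j * w = 0 := by
      apply hP.pdh (k := dm U + j + k) (l := k) (by omega) (hUa.mul ((hact t).pow j) w hw.1)
        (Hom_yLa (hL t) hw.2 j)
      intro b hb hbk; exact h b ⟨hb, hbk⟩
    exact hHL t ht k w hw.1 hw.2 (by omega) (by rw [hm, hj]; exact h1)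
  have P1 : ∀ t : ℝ, ∀ w ∈ Nk N k,
      (∀ b ∈ Np N k, (y U * (L0 + t • L1) ^ (j + 1) * b * w) T = 0) →
        y U * (L0 + t • L1) ^ (j + 1) * w = 0 := by
    intro t w hw h
    have hmem := hUa.mul ((hact t).pow (j + 1)) w hw.1
    have hhom := Hom_yLa (U := U) (hL t) hw.2 (j + 1)
    rcases k with _ | k
    · exact hP.zero_of_gt (by omega) hmem hhom
    · apply hP.pdh (l := k) (by omega) hmem hhom
      intro b hb hbk
      have := h b ⟨hb, hbk⟩
      rwa [mul_right_comm] at this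
  have P2 : ∀ t ∈ Set.Icc (0:ℝ) 1, ∀ w ∈ Np N k,
      (∀ b ∈ Np N k, (y U * (L0 + t • L1) ^ (j + 2) * w * b) T = 0) → y U * w = 0 := by
    intro t ht w hw h
    rcases k with _ | k
    · rw [(Submodule.mem_bot ℝ).mp hw, mul_zero]
    · have h1 : y U * (L0 + t • L1) ^ (j + 2) * w = 0 := by
        apply hP.pdh (k := dm U + (j + 2) + k) (l := k) (by omega)
          (hUa.mul ((hact t).pow (j + 2)) w hw.1) (Hom_yLa (hL t) hw.2 (j + 2))
        intro b hb hbk; exact h b ⟨hb, hbk⟩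
      exact hHL t ht k w hw.1 hw.2 (by omega) (by
        rw [hm, show m - 2 * k = j + 2 by omega]; exact h1)
  have P3 : ∀ t : ℝ, ∀ w ∈ Np N k, (L0 + t • L1) * w ∈ Nk N k := by
    intro t w hw
    rcases k with _ | k
    · rw [(Submodule.mem_bot ℝ).mp hw, mul_zero]; exact Submodule.zero_mem _
    · refine ⟨hact t w hw.1, ?_⟩
      have := (hL t).mul hw.2
      rwa [add_comm] at this
  obtain ⟨n, α, hα, hαi, hαs⟩ := exists_lifts (Nk N k) (LinearMap.mulLeft ℝ (y U))
  obtain ⟨n', β, hβ, hβi, hβs⟩ := exists_lifts (Np N k) (LinearMap.mulLeft ℝ (y U))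
  simp only [LinearMap.mulLeft_apply] at hαi hαs hβi hβs
  have hαm : ∀ x : Fin n → ℝ, ∑ i, x i • α i ∈ Nk N k := fun x =>
    Submodule.sum_mem _ (fun i _ => Submodule.smul_mem _ _ (hα i))
  have hβm : ∀ x : Fin n' → ℝ, ∑ i, x i • β i ∈ Np N k := fun x =>
    Submodule.sum_mem _ (fun i _ => Submodule.smul_mem _ _ (hβ i))
  have hα0 : ∀ x : Fin n → ℝ, y U * ∑ i, x i • α i = 0 → x = 0 := by
    intro x hx
    rw [Finset.mul_sum] at hx
    simp only [mul_smul_comm] at hx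
    funext i; exact (Fintype.linearIndependent_iff.mp hαi) x hx i
  have hβ0 : ∀ x : Fin n' → ℝ, y U * ∑ i, x i • β i = 0 → x = 0 := by
    intro x hx
    rw [Finset.mul_sum] at hx
    simp only [mul_smul_comm] at hx
    funext i; exact (Fintype.linearIndependent_iff.mp hβi) x hx i
  have hsgn : ((-1:ℝ)) ^ k ≠ 0 := pow_ne_zero _ (by norm_num)
  let A : ℝ → Matrix (Fin n') (Fin n') ℝ := fun t =>
    Matrix.of fun i i' => (-1:ℝ) ^ k * (y U * (L0 + t • L1) ^ (j + 2) * β i * β i') T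
  let B : ℝ → Matrix (Fin n) (Fin n) ℝ := fun t =>
    Matrix.of fun i i' => (-1:ℝ) ^ k * (y U * (L0 + t • L1) ^ j * α i * α i') T
  let C : ℝ → Matrix (Fin n') (Fin n) ℝ := fun t =>
    Matrix.of fun i i' => (-1:ℝ) ^ k * (y U * (L0 + t • L1) ^ (j + 1) * β i * α i') T
  have hcont : ∀ (p q : GrM F V) (l : ℕ),
      Continuous (fun t : ℝ => (-1:ℝ) ^ k * (y U * (L0 + t • L1) ^ l * p * q) T) := by
    intro p q l
    have : (fun t : ℝ => (-1:ℝ) ^ k * (y U * (L0 + t • L1) ^ l * p * q) T) =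
        fun t : ℝ => (-1:ℝ) ^ k * ((y U * p * q) * (L0 + t • L1) ^ l) T := by
      funext t; apply mapp_congr; ring
    rw [this]
    exact continuous_const.mul (cont_pow T L0 L1 l _)
  have key := cont_lemma A B C
    (continuous_matrix fun i i' => hcont _ _ _)
    (continuous_matrix fun i i' => hcont _ _ _)
    (continuous_matrix fun i i' => hcont _ _ _)
    (fun t => by ext i i'; simp only [A, transpose_apply, of_apply]; apply mapp_congr; ring)
    (fun t => by ext i i'; simp only [B, transpose_apply, of_apply]; apply mapp_congr; ring)
    ?_ ?_ ?_ ?_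
  · -- conclude
    obtain ⟨w, hw⟩ := hαs a ⟨ha, hka⟩
    have h1 := key t ht w (by rintro rfl; apply hne; rw [hw]; simp) (by
      simp only [C]
      rw [mv_lemma]; funext i
      rw [show y U * (L0 + t • L1) ^ (j + 1) * β i * ∑ i, w i • α i =
        (L0 + t • L1) ^ (j + 1) * β i * (y U * ∑ i, w i • α i) by ring, ← hw,
        show (L0 + t • L1) ^ (j + 1) * β i * (y U * a) =
          β i * (y U * (L0 + t • L1) ^ (j + 1) * a) by ring, hprim, mul_zero]
      simp)
    simp only [B] at h1
    rw [mv_lemma, dot_lemma] at h1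
    rw [show y U * (L0 + t • L1) ^ j * a * a = (L0 + t • L1) ^ j * a * (y U * a) by ring, hw,
      show (L0 + t • L1) ^ j * a * (y U * ∑ i, w i • α i) =
        (L0 + t • L1) ^ j * (∑ i, w i • α i) * (y U * a) by ring, hw,
      show (L0 + t • L1) ^ j * (∑ i, w i • α i) * (y U * ∑ i, w i • α i) =
        y U * (L0 + t • L1) ^ j * (∑ i, w i • α i) * (∑ i, w i • α i) by ring]
    exact h1
  · -- existence of l
    intro t
    have : ∀ i, ∃ x : Fin n → ℝ, y U * ((L0 + t • L1) * β i) = y U * ∑ i, x i • α i :=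
      fun i => hαs _ (P3 t _ (hβ i))
    choose x hx using this
    refine ⟨Matrix.of fun i i' => x i' i, ?_, ?_⟩
    · ext i i'
      simp only [C, B, of_apply, mul_apply, transpose_apply]
      have := dot_lemma T ((-1:ℝ) ^ k) (y U * (L0 + t • L1) ^ j) (α i') α (x i)
      simp only [dotProduct] at this
      rw [this]; apply mapp_congr
      rw [show y U * (L0 + t • L1) ^ (j + 1) * β i * α i' =
        (L0 + t • L1) ^ j * (y U * ((L0 + t • L1) * β i)) * α i' by ring, hx]; ring
    · ext i i'
      simp only [C, A, of_apply, mul_apply]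
      have := congrFun (mv_lemma T ((-1:ℝ) ^ k) (y U * (L0 + t • L1) ^ (j + 1)) β α (x i')) i
      simp only [mulVec, dotProduct, of_apply] at this
      rw [this]; apply mapp_congr
      rw [show y U * (L0 + t • L1) ^ (j + 2) * β i * β i' =
        (L0 + t • L1) ^ (j + 1) * β i * (y U * ((L0 + t • L1) * β i')) by ring, hx]; ring
  · intro t ht u hu
    simp only [A] at hu
    rw [mv_lemma] at hu
    apply hβ0
    apply P2 t ht _ (hβm u)
    intro b hb
    obtain ⟨x, hx⟩ := hβs b hb
    rw [show y U * (L0 + t • L1) ^ (j + 2) * (∑ i, u i • β i) * b =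
      (L0 + t • L1) ^ (j + 2) * (∑ i, u i • β i) * (y U * b) by ring, hx,
      show (L0 + t • L1) ^ (j + 2) * (∑ i, u i • β i) * (y U * ∑ i, x i • β i) =
       y U * (L0 + t • L1) ^ (j + 2) * (∑ i, x i • β i) * (∑ i, u i • β i) by ring]
    have h2 := dot_lemma T ((-1:ℝ) ^ k) (y U * (L0 + t • L1) ^ (j + 2)) (∑ i, u i • β i) β x
    rw [hu, dotProduct_zero] at h2
    exact (mul_eq_zero.mp h2.symm).resolve_left hsgn
  · intro t ht u hu
    simp only [B] at hu
    rw [mv_lemma] at hu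
    apply hα0
    apply P0 t ht _ (hαm u)
    intro b hb
    obtain ⟨x, hx⟩ := hαs b hb
    rw [show y U * (L0 + t • L1) ^ j * (∑ i, u i • α i) * b =
      (L0 + t • L1) ^ j * (∑ i, u i • α i) * (y U * b) by ring, hx,
      show (L0 + t • L1) ^ j * (∑ i, u i • α i) * (y U * ∑ i, x i • α i) =
       y U * (L0 + t • L1) ^ j * (∑ i, x i • α i) * (∑ i, u i • α i) by ring]
    have h2 := dot_lemma T ((-1:ℝ) ^ k) (y U * (L0 + t • L1) ^ j) (∑ i, u i • α i) α x
    rw [hu, dotProduct_zero] at h2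
    exact (mul_eq_zero.mp h2.symm).resolve_left hsgn
  · intro w hw hCw
    simp only [C] at hCw
    rw [mv_lemma] at hCw
    simp only [B]
    rw [mv_lemma, dot_lemma]
    have h1 : y U * (L0 + (1:ℝ) • L1) ^ (j + 1) * (∑ i, w i • α i) = 0 := by
      apply P1 1 _ (hαm w)
      intro b hb
      obtain ⟨x, hx⟩ := hβs b hb
      rw [show y U * (L0 + (1:ℝ) • L1) ^ (j + 1) * b * (∑ i, w i • α i) =
        (L0 + (1:ℝ) • L1) ^ (j + 1) * (y U * b) * (∑ i, w i • α i) by ring, hx,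
        show (L0 + (1:ℝ) • L1) ^ (j + 1) * (y U * ∑ i, x i • β i) * (∑ i, w i • α i) =
        y U * (L0 + (1:ℝ) • L1) ^ (j + 1) * (∑ i, x i • β i) * (∑ i, w i • α i) by ring]
      have h2 := dot_lemma T ((-1:ℝ) ^ k) (y U * (L0 + (1:ℝ) • L1) ^ (j + 1)) (∑ i, w i • α i) β x
      rw [hCw, dotProduct_zero] at h2
      exact (mul_eq_zero.mp h2.symm).resolve_left hsgn
    have := hHR k _ (hαm w).1 (hαm w).2 (by omega) (by rw [hm, hj]; exact h1)
      (fun h => hw (hα0 w h))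
    rwa [hm, hj] at this

end ContHR
end HW


namespace HW
open Classical
set_option linter.unusedSectionVars false

section Step
variable {F V : Type*} [Field F] [AddCommGroup V] [Module F V] [Finite V]

theorem lemK {T U : Submodule F V} {E : Finset V} {N : Submodule ℝ (GrM F V)}
    {E' : Finset V} {c : V → ℝ} (hmem : ∀ v ∈ E', v ∈ T) (hne : ∀ v ∈ E', v ≠ 0)
    (hUT : U ≤ T)
    (hc : ∀ v ∈ E', 0 ≤ c v)
    (hHR : ∀ v ∈ E', 0 < c v → v ∉ U → HR T (U ⊔ ln v) N (∑ v ∈ E', c v • yv F v))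
    (hNS : ∀ k : ℕ, 2 * k < dm T - dm U → ∀ a ∈ N, Hom k a →
      (∀ v ∈ E', 0 < c v → yv F v * y U * a = 0) → y U * a = 0) :
    HL T U N (∑ v ∈ E', c v • yv F v) := by
  obtain ⟨L, hL⟩ : ∃ L, L = ∑ v ∈ E', c v • yv F v := ⟨_, rfl⟩
  rw [← hL] at hHR ⊢
  intro k a ha hk h2k h0
  rcases Nat.lt_or_ge (2 * k) (dm T - dm U) with hlt | hge
  swap
  · rw [show dm T - dm U - 2 * k = 0 by omega] at h0
    simpa using h0
  obtain ⟨j, hj⟩ : ∃ j, dm T - dm U - 2 * k = j + 1 := ⟨dm T - dm U - 2 * k - 1, by omega⟩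
  rw [hj] at h0
  have hterm : ∀ v ∈ E', 0 < c v → yv F v * y U * a ≠ 0 →
      0 < (-1:ℝ) ^ k * (yv F v * y U * L ^ j * a * a) T := by
    intro v hv hcv hnz
    have hvU : v ∉ U := by
      intro hm; apply hnz; rw [yv_mul_mem (hne v hv) hm, zero_mul]
    have hd : dm (U ⊔ ln v) = dm U + 1 := dm_sup_ln hvU
    have := hHR v hv hcv hvU k a ha hk (by omega) (by
      rw [hd, show dm T - (dm U + 1) - 2 * k + 1 = j + 1 by omega, ← yv_mul_not hvU,
        mul_assoc (yv F v), mul_assoc (yv F v), h0, mul_zero]) (by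
      rw [← yv_mul_not hvU]; exact hnz)
    rwa [hd, show dm T - (dm U + 1) - 2 * k = j by omega, ← yv_mul_not hvU] at this
  have hnn : ∀ v ∈ E', 0 ≤ c v * ((-1:ℝ) ^ k * (yv F v * y U * L ^ j * a * a) T) := by
    intro v hv
    rcases (hc v hv).eq_or_lt with h | h
    · rw [← h, zero_mul]
    · by_cases hz : yv F v * y U * a = 0
      · rw [show yv F v * y U * L ^ j * a * a = (yv F v * y U * a) * L ^ j * a by ring, hz]
        simp
      · exact (mul_pos h (hterm v hv h hz)).le
  have hsum : ∑ v ∈ E', c v * ((-1:ℝ) ^ k * (yv F v * y U * L ^ j * a * a) T) = 0 := by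
    have : ∑ v ∈ E', c v * ((-1:ℝ) ^ k * (yv F v * y U * L ^ j * a * a) T) =
        (-1:ℝ) ^ k * (y U * L ^ (j + 1) * a * a) T := by
      have e1 : y U * L ^ (j + 1) * a * a = ∑ v ∈ E', c v • (yv F v * (y U * L ^ j * a * a)) := by
        rw [show y U * L ^ (j + 1) * a * a = L * (y U * L ^ j * a * a) by ring]
        conv_lhs => arg 1; rw [hL]
        rw [Finset.sum_mul]
        simp only [smul_mul_assoc]
      rw [e1, sum_app, Finset.mul_sum]
      apply Finset.sum_congr rfl; intro v _
      rw [smul_app,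
        show yv F v * y U * L ^ j * a * a = yv F v * (y U * L ^ j * a * a) by ring]
      ring
    rw [this, h0, zero_mul]; simp
  have hall := (Finset.sum_eq_zero_iff_of_nonneg hnn).mp hsum
  apply hNS k hlt a ha hk
  intro v hv hcv
  by_contra hz
  exact (mul_pos hcv (hterm v hv hcv hz)).ne' (hall v hv)

/-- The part of the induction hypothesis inherited before passing to a minimal submodule. -/
structure Half (T : Submodule F V) (E : Finset V) (N : Submodule ℝ (GrM F V)) : Prop extends
    Pre T E N where
  hr : ∀ U, Fl E U → HR T U N (LE F E)
  wns : ∀ U, Fl E U → ∀ k : ℕ, 2 * k < dm T - dm U → ∀ a ∈ N, Hom k a →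
    (∀ v ∈ E, yv F v * y U * a = 0) → y U * a = 0
  cf : ∀ U, Fl E U → ∀ a ∈ N, (∀ v ∈ E, yv F v * y U * a = 0) →
    ∃ a' ∈ N, y U * a' = y U * a ∧ ∀ v ∈ E, v ∉ U → yv F v * a' = 0

theorem sup_ln_eq {U : Submodule F V} {e p : V} (he : e ∉ U) (hp : p ∈ U ⊔ ln e) (hpU : p ∉ U) :
    U ⊔ ln p = U ⊔ ln e := by
  apply eq_of_dm
  · exact sup_le le_sup_left (ln_le hp)
  · rw [dm_sup_ln he, dm_sup_ln hpU]

theorem step_wns {T : Submodule F V} {E : Finset V} {N : Submodule ℝ (GrM F V)} (hA : Adm T E)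
    {e : V} (heT : e ∈ T) (he0 : e ≠ 0) (hG : Good T (insert e E) N) :
    ∀ U, Fl (insert e E) U → ∀ k : ℕ, 2 * k < dm T - dm U → ∀ a ∈ N, Hom k a →
    (∀ v ∈ E, yv F v * y U * a = 0) → y U * a = 0 := by
  intro U hU k hk a ha hka h0
  have hUT : ¬ T ≤ U := by intro h; have := dm_mono h; omega
  have hUT' : U ≠ T := by rintro rfl; exact hUT le_rfl
  have key : yv F e * y U * a = 0 := by
    by_cases heU : e ∈ U
    · rw [yv_mul_mem he0 heU, zero_mul]
    by_cases hp : ∃ p ∈ E, p ∈ U ⊔ ln e ∧ p ∉ U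
    · obtain ⟨p, hpE, hp1, hp2⟩ := hp
      rw [yv_mul_not heU, ← sup_ln_eq heU hp1 hp2, ← yv_mul_not hp2]
      exact h0 p hpE
    push Not at hp
    rw [yv_mul_not heU]
    have hd := dm_sup_ln heU
    apply hG.ns _ (hU.sup (Finset.mem_insert_self _ _)) ?_ k (by omega) a ha hka
    · intro v hv
      rcases Finset.mem_insert.mp hv with rfl | hv
      · rw [yv_mul_mem he0 (le_sup_right (a := U) (Submodule.mem_span_singleton_self _)), zero_mul]
      · rw [← yv_mul_not heU, show yv F v * (yv F e * y U) * a = yv F e * (yv F v * y U * a) by ring,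
          h0 v hv, mul_zero]
    · intro hT
      obtain ⟨p, hpE, hpU⟩ := hA.exists_not_mem hUT
      exact hpU (hp p hpE (by rw [hT]; exact hA.mem hpE))
  apply hG.ns U hU hUT' k hk.le a ha hka
  intro v hv
  rcases Finset.mem_insert.mp hv with rfl | hv
  · exact key
  · exact h0 v hv

theorem step_cf {T : Submodule F V} {E : Finset V} {N : Submodule ℝ (GrM F V)}
    {e : V} (he0 : e ≠ 0) (hA : Adm T E) (hG : Good T (insert e E) N) :
    ∀ U, Fl E U → ∀ a ∈ N, (∀ v ∈ E, yv F v * y U * a = 0) →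
    ∃ a' ∈ N, y U * a' = y U * a ∧ ∀ v ∈ E, v ∉ U → yv F v * a' = 0 := by
  intro U hU a ha h0
  have hU' : Fl (insert e E) U := hU.mono (Finset.subset_insert _ _)
  by_cases key : yv F e * y U * a = 0
  · obtain ⟨a', h1, h2, h3⟩ := hG.cf U hU' a ha (by
      intro v hv
      rcases Finset.mem_insert.mp hv with rfl | hv
      · exact key
      · exact h0 v hv)
    exact ⟨a', h1, h2, fun v hv => h3 v (Finset.mem_insert_of_mem hv)⟩
  have heU : e ∉ U := by
    intro h; apply key; rw [yv_mul_mem he0 h, zero_mul]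
  have hp : ∀ p ∈ E, p ∉ U → p ∉ U ⊔ ln e := by
    intro p hpE hpU hp
    apply key
    rw [yv_mul_not heU, ← sup_ln_eq heU hp hpU, ← yv_mul_not hpU]
    exact h0 p hpE
  obtain ⟨a1, ha1, h1, h2⟩ := hG.cf (U ⊔ ln e) (hU'.sup (Finset.mem_insert_self _ _)) a ha (by
    intro v hv
    rcases Finset.mem_insert.mp hv with rfl | hv
    · rw [yv_mul_mem he0 (le_sup_right (a := U) (Submodule.mem_span_singleton_self _)), zero_mul]
    · rw [← yv_mul_not heU, show yv F v * (yv F e * y U) * a = yv F e * (yv F v * y U * a) by ring,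
        h0 v hv, mul_zero])
  obtain ⟨b, hb, h3, h4⟩ := hG.cf U hU' (a - a1) (N.sub_mem ha ha1) (by
    intro v hv
    rcases Finset.mem_insert.mp hv with rfl | hv
    · rw [yv_mul_not heU, mul_sub, h1, sub_self]
    · rw [mul_sub, h0 v hv, zero_sub, neg_eq_zero]
      by_cases hvU : v ∈ U
      · rw [yv_mul_mem (hA.ne v hv) hvU, zero_mul]
      · rw [mul_right_comm, h2 v (Finset.mem_insert_of_mem hv) (hp v hv hvU), zero_mul])
  refine ⟨a1 + b, N.add_mem ha1 hb, ?_, ?_⟩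
  · rw [mul_add, h3]; ring
  · intro v hv hvU
    rw [mul_add, h2 v (Finset.mem_insert_of_mem hv) (hp v hv hvU),
      h4 v (Finset.mem_insert_of_mem hv) hvU, add_zero]

theorem step_hr {T : Submodule F V} {E : Finset V} {N : Submodule ℝ (GrM F V)} (hA : Adm T E)
    {e : V} (heT : e ∈ T) (he0 : e ≠ 0) (heE : e ∉ E) (hG : Good T (insert e E) N) (n : ℕ) :
    ∀ U, Fl (insert e E) U → dm T - dm U = n → ∀ t ∈ Set.Icc (0:ℝ) 1,
      HR T U N (LE F E + t • yv F e) := by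
  have hA' : Adm T (insert e E) := by
    refine ⟨?_, ?_⟩
    · intro v hv
      rcases Finset.mem_insert.mp hv with rfl | hv
      · exact he0
      · exact hA.ne v hv
    · rw [Finset.coe_insert, Submodule.span_insert, hA.span, sup_eq_right]
      exact ln_le heT
  induction n using Nat.strong_induction_on with
  | _ n ih =>
    intro U hU hn
    have hUT := hU.le hA'
    have hP := hG.toPre
    apply contHR hP hUT (hP.y_mem hU)
    · intro t; exact (Hom_LE hA.ne).add ((Hom_yv he0).smul t)
    · intro t
      exact (Act.sum (fun v hv => hP.mul v (Finset.mem_insert_of_mem hv))).add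
        (Act.smul (hP.mul e (Finset.mem_insert_self _ _)) t)
    · intro t ht
      have hsum : ∑ v ∈ insert e E, (if v = e then t else 1) • yv F v = LE F E + t • yv F e := by
        rw [Finset.sum_insert heE, if_pos rfl, add_comm]
        congr 1
        apply Finset.sum_congr rfl
        intro v hv
        rw [if_neg (by rintro rfl; exact heE hv), one_smul]
      rw [← hsum]
      apply lemK (fun v hv => hA'.mem hv) hA'.ne hUT (E := E)
      · intro v _
        split_ifs
        · exact ht.1
        · exact zero_le_one
      · intro v hv _ hvU
        rw [hsum]
        have hd := dm_sup_ln hvU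
        have hf := hU.sup hv
        have := dm_mono (hf.le hA')
        exact ih (dm T - dm (U ⊔ ln v)) (by omega) _ hf rfl t ht
      · intro k hk a ha hka h0
        apply step_wns hA heT he0 hG U hU k hk a ha hka
        intro v hv
        apply h0 v (Finset.mem_insert_of_mem hv)
        rw [if_neg (by rintro rfl; exact heE hv)]; exact zero_lt_one
    · have := hG.hr U hU
      rwa [LE, Finset.sum_insert heE, add_comm, ← one_smul ℝ (yv F e)] at this

theorem step_half {T : Submodule F V} {E : Finset V} {N : Submodule ℝ (GrM F V)} (hA : Adm T E)
    {e : V} (heT : e ∈ T) (he0 : e ≠ 0) (heE : e ∉ E) (hG : Good T (insert e E) N) :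
    Half T E N := by
  have hP := hG.toPre
  refine ⟨⟨hP.rt, hP.gr, hP.one, fun v hv => hP.mul v (Finset.mem_insert_of_mem hv), hP.pd⟩,
    ?_, ?_, step_cf he0 hA hG⟩
  · intro U hU
    have := step_hr hA heT he0 heE hG _ U (hU.mono (Finset.subset_insert _ _)) rfl 0 (by simp)
    rwa [zero_smul, add_zero] at this
  · intro U hU
    exact step_wns hA heT he0 hG U (hU.mono (Finset.subset_insert _ _))

end Step
end HW


namespace HW
open Classical
set_option linter.unusedSectionVars false

section Finish
variable {F V : Type*} [Field F] [AddCommGroup V] [Module F V] [Finite V]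

theorem exists_rep {T : Submodule F V} {N : Submodule ℝ (GrM F V)}
    (hpd : ∀ a ∈ N, (∀ b ∈ N, (a * b) T = 0) → a = 0) (g : GrM F V →ₗ[ℝ] GrM F V →ₗ[ℝ] ℝ) :
    ∃ θ : GrM F V →ₗ[ℝ] GrM F V, ∀ x, θ x ∈ N ∧ ∀ b ∈ N, (θ x * b) T = g x b := by
  let Φ : N →ₗ[ℝ] Module.Dual ℝ N :=
    ((LinearMap.mul ℝ (GrM F V)).compr₂ (ev T)).domRestrict₁₂ N N
  have hΦ : ∀ a b : N, Φ a b = ((a : GrM F V) * (b : GrM F V)) T := fun a b => rfl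
  have hinj : Function.Injective Φ := by
    rw [← LinearMap.ker_eq_bot, LinearMap.ker_eq_bot']
    intro a ha
    apply Subtype.ext
    apply hpd a a.2
    intro b hb
    have := LinearMap.congr_fun ha ⟨b, hb⟩
    rw [hΦ] at this; exact this
  have hfr : Module.finrank ℝ N = Module.finrank ℝ (Module.Dual ℝ N) := Subspace.dual_finrank_eq.symm
  let e := LinearEquiv.ofInjectiveOfFinrankEq Φ hinj hfr
  have he : ∀ f : Module.Dual ℝ N, Φ (e.symm f) = f := fun f => by
    have := e.apply_symm_apply f
    exact this
  refine ⟨N.subtype ∘ₗ e.symm.toLinearMap ∘ₗ (LinearMap.lcomp ℝ ℝ N.subtype) ∘ₗ g, ?_⟩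
  intro x
  refine ⟨(e.symm _).2, ?_⟩
  intro b hb
  have := LinearMap.congr_fun (he ((LinearMap.lcomp ℝ ℝ N.subtype) (g x))) ⟨b, hb⟩
  rw [hΦ] at this
  exact this

theorem exists_repr {T : Submodule F V} {N : Submodule ℝ (GrM F V)}
    (hpd : ∀ a ∈ N, (∀ b ∈ N, (a * b) T = 0) → a = 0) (f : GrM F V →ₗ[ℝ] ℝ) :
    ∃ z ∈ N, ∀ b ∈ N, (z * b) T = f b := by
  obtain ⟨θ, hθ⟩ := exists_rep hpd ((ev ⊥ : GrM F V →ₗ[ℝ] ℝ).smulRight f)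
  refine ⟨θ 1, (hθ 1).1, ?_⟩
  intro b hb
  rw [(hθ 1).2 b hb]
  simp [one_def, y_app]

theorem pr_swap {T : Submodule F V} {j : ℕ} (hj : j ≤ dm T) (x b : GrM F V) :
    (pr j x * b) T = (x * pr (dm T - j) b) T := by
  rw [mul_app_pr (Hom_pr j x) hj, mul_comm x, mul_app_pr (Hom_pr (dm T - j) b) (by omega),
    show dm T - (dm T - j) = j by omega, mul_comm]

theorem RT.pr_gt {U : Submodule F V} {b : GrM F V} (h : RT U b) {j : ℕ} (hj : dm U < j) :
    HW.pr j b = 0 := by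
  apply GrM.ext'; intro W
  rw [pr_app]; split_ifs with h1
  · by_contra h2
    have := dm_mono (h W h2)
    omega
  · rfl

theorem Pre.gr_comm {T : Submodule F V} {E : Finset V} {N : Submodule ℝ (GrM F V)}
    (hP : Pre T E N) {x z : GrM F V} (hz : z ∈ N) {k : ℕ}
    (h : ∀ b ∈ N, k ≤ dm T → (x * b) T = (z * pr (dm T - k) b) T) (hx : x ∈ N)
    (hk : dm T < k → x = 0) : x = pr k z := by
  rcases Nat.lt_or_ge (dm T) k with hlt | hle
  · rw [hk hlt, (hP.rt z hz).pr_gt hlt]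
  · rw [← sub_eq_zero]
    apply hP.pd _ (N.sub_mem hx (hP.gr z hz k))
    intro b hb
    rw [sub_mul, sub_app, h b hb hle, pr_swap hle, sub_self]

/-- Self-adjoint operators with nonzero eigenvalue at `1` are injective on minimal modules. -/
theorem min_inj {U : Submodule F V} {E : Finset V} {M : Submodule ℝ (GrM F V)} (hP : Pre U E M)
    (hmin : ∀ M1, M1 ≤ M → Pre U E M1 → M1 = M) (θ : GrM F V →ₗ[ℝ] GrM F V)
    (hθ : ∀ x ∈ M, θ x ∈ M) (hs : ∀ x ∈ M, ∀ z ∈ M, (θ x * z) U = (x * θ z) U)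
    (hm : ∀ v ∈ E, ∀ x ∈ M, θ (yv F v * x) = yv F v * θ x)
    (hg : ∀ x ∈ M, ∀ k, θ (pr k x) = pr k (θ x))
    {c : ℝ} (hc : c ≠ 0) (h1 : θ 1 = c • 1) : ∀ b ∈ M, θ b = 0 → b = 0 := by
  have hD0 : ∀ x ∈ M, (θ - c • (LinearMap.id : GrM F V →ₗ[ℝ] GrM F V)) x ∈ M := by
    intro x hx; exact M.sub_mem (hθ x hx) (M.smul_mem c hx)
  let D : M →ₗ[ℝ] M := (θ - c • (LinearMap.id : GrM F V →ₗ[ℝ] GrM F V)).restrict hD0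
  have hD : ∀ x : M, ((D x : M) : GrM F V) = θ x - c • (x : GrM F V) := fun x => rfl
  obtain ⟨n, hn, hn1⟩ := ((LinearMap.eventually_isCompl_ker_pow_range_pow D).and
    (Filter.eventually_ge_atTop 1)).exists
  have comm : ∀ (S : GrM F V →ₗ[ℝ] GrM F V) (hS : ∀ x ∈ M, S x ∈ M),
      (∀ x ∈ M, θ (S x) = S (θ x)) → ∀ x ∈ LinearMap.ker (D ^ n),
        (⟨S x, hS x x.2⟩ : M) ∈ LinearMap.ker (D ^ n) := by
    intro S hS hcomm x hx
    have hco : Commute (S.restrict hS) D := by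
      apply LinearMap.ext; intro z
      apply Subtype.ext
      change S ((D z : M) : GrM F V) = θ (S z) - c • S z
      rw [hD, map_sub, map_smul, hcomm z z.2]
    have h2 := LinearMap.congr_fun (hco.pow_right n).eq x
    rw [Module.End.mul_apply, Module.End.mul_apply, LinearMap.mem_ker.mp hx, map_zero] at h2
    exact h2.symm
  have hsD : ∀ j : ℕ, ∀ x z : M, (((D ^ j) x : M) * (z : GrM F V) : GrM F V) U =
      ((x : GrM F V) * ((D ^ j) z : M)) U := by
    intro j
    induction j with
    | zero => intro x z; rfl
    | succ j ih =>
      intro x z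
      have e1 : (D ^ (j + 1)) x = (D ^ j) (D x) := by rw [pow_succ]; rfl
      have e2 : (D ^ (j + 1)) z = D ((D ^ j) z) := by rw [pow_succ']; rfl
      rw [e1, e2, ih, hD, hD, sub_mul, mul_sub, sub_app, sub_app, smul_mul_assoc, mul_smul_comm,
        hs _ x.2 _ ((D ^ j) z).2]
  have hK := hmin ((LinearMap.ker (D ^ n)).map M.subtype) (Submodule.map_subtype_le _ _) ?_
  · intro b hb hb0
    have h2 : b ∈ (LinearMap.ker (D ^ n)).map M.subtype := by rw [hK]; exact hb
    obtain ⟨⟨x, hx⟩, hxk, rfl⟩ := h2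
    have h3 : ∀ j : ℕ, (((D ^ j) ⟨x, hx⟩ : M) : GrM F V) = (-c) ^ j • x := by
      intro j
      induction j with
      | zero => simp
      | succ j ih =>
        have e2 : (D ^ (j + 1)) ⟨x, hx⟩ = D ((D ^ j) ⟨x, hx⟩) := by rw [pow_succ']; rfl
        have hx0 : θ x = 0 := hb0
        rw [e2, hD, ih, map_smul, hx0, smul_zero, zero_sub, pow_succ', smul_smul, ← neg_smul]
        congr 1; ring
    have h4 := h3 n
    rw [LinearMap.mem_ker.mp hxk] at h4
    have h5 : (-c) ^ n ≠ 0 := pow_ne_zero _ (neg_ne_zero.mpr hc)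
    exact (smul_eq_zero.mp h4.symm).resolve_left h5
  · refine ⟨?_, ?_, ?_, ?_, ?_⟩
    · rintro _ ⟨x, _, rfl⟩; exact hP.rt x x.2
    · rintro _ ⟨x, hx, rfl⟩ k
      exact ⟨_, comm (pr k) (fun z hz => hP.gr z hz k) (fun z hz => hg z hz k) x hx, rfl⟩
    · refine ⟨⟨1, hP.one⟩, ?_, rfl⟩
      have hz : D ⟨1, hP.one⟩ = 0 := by
        apply Subtype.ext; rw [hD]; change θ 1 - c • 1 = 0; rw [h1, sub_self]
      obtain ⟨j, rfl⟩ := Nat.exists_eq_succ_of_ne_zero (show n ≠ 0 by omega)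
      change (D ^ (j + 1)) _ = 0
      rw [pow_succ, Module.End.mul_apply, hz, map_zero]
    · rintro v hv _ ⟨x, hx, rfl⟩
      exact ⟨_, comm (LinearMap.mulLeft ℝ (yv F v)) (fun z hz => hP.mul v hv z hz)
        (fun z hz => hm v hv z hz) x hx, rfl⟩
    · rintro _ ⟨x, hx, rfl⟩ h
      apply hP.pd x x.2
      intro b hb
      have htop : (⟨b, hb⟩ : M) ∈ LinearMap.ker (D ^ n) ⊔ LinearMap.range (D ^ n) := by
        rw [hn.sup_eq_top]; trivial
      obtain ⟨p, hp, q, ⟨r, rfl⟩, hpq⟩ := Submodule.mem_sup.mp htop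
      have e : b = (p : GrM F V) + ((D ^ n) r : M) := (congrArg Subtype.val hpq).symm
      have h2 := h p ⟨p, hp, rfl⟩
      have h3 := hsD n x r
      rw [LinearMap.mem_ker.mp hx] at h3
      rw [e, mul_add, add_app, ← h3]
      simpa using h2

/-- The key step: the borderline case of the non-degeneracy for a minimal module. -/
theorem min_ns {T U : Submodule F V} {E : Finset V} {N M : Submodule ℝ (GrM F V)} (hP : Pre T E N)
    (hA : Adm T E)
    (hmin : ∀ N1, N1 ≤ N → Pre T E N1 → N1 = N)
    (hPU : Pre U (E.filter (· ∈ U)) M)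
    (hminU : ∀ N1, N1 ≤ M → Pre U (E.filter (· ∈ U)) N1 → N1 = M)
    {k : ℕ} (hk : 1 ≤ k) (hd : dm T = dm U + 2 * k)
    {a : GrM F V} (ha : a ∈ N) (hka : Hom k a) (hav : ∀ v ∈ E, v ∉ U → yv F v * a = 0)
    (hc : (y U * a * a) T ≠ 0) : False := by
  -- the projection
  obtain ⟨P, hPr⟩ := exists_rep hP.pd ((LinearMap.mul ℝ (GrM F V)).compr₂ (ev T))
  have hPm : ∀ x, P x ∈ N := fun x => (hPr x).1
  have hPb : ∀ x, ∀ b ∈ N, (P x * b) T = (x * b) T := fun x b hb => (hPr x).2 b hb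
  have hPa : P a = a := by
    rw [← sub_eq_zero]
    apply hP.pd _ (N.sub_mem (hPm a) ha)
    intro b hb
    rw [sub_mul, sub_app, hPb a b hb, sub_self]
  have hPv : ∀ v ∈ E, ∀ x, P (yv F v * x) = yv F v * P x := by
    intro v hv x
    rw [← sub_eq_zero]
    apply hP.pd _ (N.sub_mem (hPm _) (hP.mul v hv _ (hPm x)))
    intro b hb
    rw [sub_mul, sub_app, hPb _ b hb, show yv F v * P x * b = P x * (yv F v * b) by ring,
      hPb _ _ (hP.mul v hv b hb), show yv F v * x * b = x * (yv F v * b) by ring, sub_self]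
  have hPg : ∀ x, ∀ j ≤ dm T, P (pr j x) = pr j (P x) := by
    intro x j hj
    apply hP.gr_comm (hPm x) _ (hPm _) (fun h => by omega)
    intro b hb _
    rw [hPb _ b hb, hPb x _ (hP.gr b hb _), pr_swap hj]
  have hPab : ∀ n ∈ N, ∀ x, (n * P x) T = (n * x) T := by
    intro n hn x; rw [mul_comm, hPb x n hn, mul_comm]
  -- the operator
  let g : GrM F V →ₗ[ℝ] GrM F V →ₗ[ℝ] ℝ := (((LinearMap.mul ℝ (GrM F V)).compr₂ (ev T)).compl₁₂
    (P ∘ₗ LinearMap.mulRight ℝ a) (LinearMap.mulRight ℝ a))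
  have hg : ∀ x b, g x b = (P (x * a) * (b * a)) T := fun x b => rfl
  obtain ⟨θ, hθ⟩ := exists_rep hPU.pd g
  have hθm : ∀ x, θ x ∈ M := fun x => (hθ x).1
  have hθb : ∀ x, ∀ b ∈ M, (θ x * b) U = (P (x * a) * (b * a)) T := fun x b hb => (hθ x).2 b hb
  have hpra : ∀ x j, pr (j + k) (x * a) = pr j x * a := by
    intro x j
    rw [mul_comm x, add_comm j, pr_mul hka, mul_comm]
  have hinj := min_inj hPU hminU θ (fun x _ => hθm x) ?_ ?_ ?_ hc ?_
  · -- contradiction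
    have hsurj : ∀ z ∈ M, ∃ b ∈ M, θ b = z := by
      let θ' : M →ₗ[ℝ] M := θ.restrict (fun x _ => hθm x)
      have hi : Function.Injective θ' := by
        rw [← LinearMap.ker_eq_bot, LinearMap.ker_eq_bot']
        intro x hx
        exact Subtype.ext (hinj x x.2 (congrArg Subtype.val hx))
      intro z hz
      obtain ⟨b, hb⟩ := (LinearMap.injective_iff_surjective.mp hi) ⟨z, hz⟩
      exact ⟨b, b.2, congrArg Subtype.val hb⟩
    let N1 : Submodule ℝ (GrM F V) :=
      { carrier := {n | n ∈ N ∧ ∀ b ∈ M, (n * (b * a)) T = 0}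
        add_mem' := fun {p q} hp hq => ⟨N.add_mem hp.1 hq.1, fun b hb => by
          rw [add_mul, add_app, hp.2 b hb, hq.2 b hb, add_zero]⟩
        zero_mem' := ⟨N.zero_mem, fun b _ => by rw [zero_mul]; rfl⟩
        smul_mem' := fun c p hp => ⟨N.smul_mem c hp.1, fun b hb => by
          rw [smul_mul_assoc, smul_app, hp.2 b hb, mul_zero]⟩ }
    have hN1 : N1 = N := by
      apply hmin N1 (fun x hx => hx.1)
      refine ⟨fun n hn => hP.rt n hn.1, ?_, ?_, ?_, ?_⟩
      · intro n hn j
        refine ⟨hP.gr n hn.1 j, ?_⟩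
        intro b hb
        rcases Nat.lt_or_ge (dm T) j with hlt | hle
        · exact mul_app_gt (Hom_pr _ _) hlt _
        · rw [pr_swap hle]
          rcases Nat.lt_or_ge (dm T - j) k with h1 | h1
          · rw [mul_comm b a, pr_mul_lt hka h1, mul_zero]; rfl
          · rw [show dm T - j = (dm T - j - k) + k by omega, hpra]
            exact hn.2 _ (hPU.gr b hb _)
      · refine ⟨hP.one, ?_⟩
        intro b hb
        rw [one_mul, mul_comm, mul_app_pr hka (by omega), (hPU.rt b hb).pr_gt (by omega), mul_zero]
        rfl
      · intro v hv n hn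
        refine ⟨hP.mul v hv n hn.1, ?_⟩
        intro b hb
        by_cases hvU : v ∈ U
        · rw [show yv F v * n * (b * a) = n * ((yv F v * b) * a) by ring]
          exact hn.2 _ (hPU.mul v (by simp [hv, hvU]) b hb)
        · rw [show yv F v * n * (b * a) = n * b * (yv F v * a) by ring, hav v hv hvU, mul_zero]
          rfl
      · intro n hn h
        apply hP.pd n hn.1
        intro c hcN
        obtain ⟨z, hz, hzb⟩ := exists_repr hPU.pd
          ((ev T) ∘ₗ (LinearMap.mulLeft ℝ c) ∘ₗ (LinearMap.mulRight ℝ a))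
        obtain ⟨b, hb, hbz⟩ := hsurj z hz
        have h1 : c - P (b * a) ∈ N1 := by
          refine ⟨N.sub_mem hcN (hPm _), ?_⟩
          intro b' hb'
          rw [sub_mul, sub_app, ← hθb b b' hb', hbz, hzb b' hb']
          simp
        have h2 := h _ h1
        have h3 := hn.2 b hb
        rw [mul_sub, sub_app, hPab n hn.1, h3, sub_zero] at h2
        exact h2
    have ha0 : a = 0 := by
      apply hP.pd a ha
      intro b hb
      have : b ∈ N1 := by rw [hN1]; exact hb
      have h2 := this.2 1 hPU.one
      rwa [one_mul, mul_comm] at h2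
    apply hc; rw [ha0, mul_zero]; rfl
  · intro x hx z hz
    rw [hθb x z hz, mul_comm x (θ z), hθb z x hx, ← hPab _ (hPm _) (z * a),
      mul_comm (P (x * a)), hPab _ (hPm _) (x * a)]
  · intro v hv x hx
    have hvE : v ∈ E := (Finset.mem_filter.mp hv).1
    rw [← sub_eq_zero]
    apply hPU.pd _ (M.sub_mem (hθm _) (hPU.mul v hv _ (hθm x)))
    intro b hb
    rw [sub_mul, sub_app, hθb _ b hb, show yv F v * θ x * b = θ x * (yv F v * b) by ring,
      hθb _ _ (hPU.mul v hv b hb), mul_assoc (yv F v), hPv v hvE,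
      show yv F v * P (x * a) * (b * a) = P (x * a) * (yv F v * b * a) by ring, sub_self]
  · intro x hx j
    apply hPU.gr_comm (hθm x) _ (hθm _)
    · intro h; rw [(hPU.rt x hx).pr_gt h, map_zero]
    · intro b hb hj
      rw [hθb _ b hb, hθb x _ (hPU.gr b hb _), ← hpra, hPg _ _ (by omega), pr_swap (by omega),
        show dm T - (j + k) = (dm U - j) + k by omega, hpra]
  · rw [← sub_eq_zero]
    apply hPU.pd _ (M.sub_mem (hθm _) (M.smul_mem _ hPU.one))
    intro b hb
    rw [sub_mul, sub_app, hθb _ b hb, one_mul, hPa, smul_mul_assoc, one_mul, smul_app]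
    have h1 : pr (dm U) b = b U • y U := by
      apply GrM.ext'; intro W
      rw [pr_app, smul_app, y_app]
      by_cases hW : W = U
      · rw [if_pos (by rw [hW]), if_pos hW, hW, mul_one]
      · rw [if_neg hW, mul_zero]
        split_ifs with h2
        · by_contra h3
          exact hW (eq_of_dm (hPU.rt b hb W h3) h2.ge)
        · rfl
    have h2 : Hom (2 * k) (a * a) := by rw [two_mul]; exact hka.mul hka
    rw [show a * (b * a) = a * a * b by ring, mul_app_pr h2 (by omega),
      show dm T - 2 * k = dm U by omega, h1, mul_smul_comm, smul_app,
      show a * a * y U = y U * a * a by ring]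
    ring

theorem finish {T : Submodule F V} {E : Finset V} {N' : Submodule ℝ (GrM F V)} (hA : Adm T E)
    (hH : Half T E N')
    (ih : ∀ U, Fl E U → U ≠ T → ∃ M, Good U (E.filter (· ∈ U)) M) :
    ∃ N, Good T E N := by
  obtain ⟨N, ⟨hNN, hP⟩, hNmin⟩ := WellFounded.has_min
    (InvImage.wf (fun N : Submodule ℝ (GrM F V) => Module.finrank ℝ N) Nat.lt_wfRel.wf)
    {N | N ≤ N' ∧ Pre T E N} ⟨N', le_rfl, hH.toPre⟩
  have hmin : ∀ N1, N1 ≤ N → Pre T E N1 → N1 = N := by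
    intro N1 h1 h2
    have := hNmin N1 ⟨h1.trans hNN, h2⟩
    exact Submodule.eq_of_le_of_finrank_le h1 (not_lt.mp this)
  have hhr : ∀ U, Fl E U → HR T U N (LE F E) := fun U hU k a ha => hH.hr U hU k a (hNN ha)
  have hcf : ∀ U, Fl E U → ∀ a ∈ N, (∀ v ∈ E, yv F v * y U * a = 0) →
    ∃ a' ∈ N, y U * a' = y U * a ∧ ∀ v ∈ E, v ∉ U → yv F v * a' = 0 := by
    intro U hU a ha h0
    obtain ⟨a', ha', h1, h2⟩ := hH.cf U hU a (hNN ha) h0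
    obtain ⟨p, hp, hpb⟩ := exists_repr hP.pd ((ev T) ∘ₗ (LinearMap.mulLeft ℝ a'))
    simp only [LinearMap.comp_apply, LinearMap.mulLeft_apply, ev_apply] at hpb
    refine ⟨p, hp, ?_, ?_⟩
    · rw [← sub_eq_zero]
      apply hP.pd _ (N.sub_mem (hP.y_mem hU p hp) (hP.y_mem hU a ha))
      intro b hb
      rw [sub_mul, sub_app, show y U * p * b = p * (y U * b) by ring, hpb _ (hP.y_mem hU b hb),
        ← h1, show a' * (y U * b) = y U * a' * b by ring, sub_self]
    · intro v hv hvU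
      apply hP.pd _ (hP.mul v hv p hp)
      intro b hb
      rw [show yv F v * p * b = p * (yv F v * b) by ring, hpb _ (hP.mul v hv b hb),
        show a' * (yv F v * b) = yv F v * a' * b by ring, h2 v hv hvU, zero_mul]
      rfl
  refine ⟨N, hP, hhr, ?_, hcf, hmin⟩
  intro U hU hUT k hk a ha hka h0
  rcases Nat.lt_or_ge (2 * k) (dm T - dm U) with hlt | hge
  · exact hH.wns U hU k hlt a (hNN ha) hka h0
  have hUle := hU.le hA
  have hdlt : dm U < dm T := by
    by_contra h; exact hUT (eq_of_dm hUle (not_lt.mp h))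
  by_contra hne
  obtain ⟨a0, ha0, h1, h2⟩ := hcf U hU a ha h0
  obtain ⟨M, hM⟩ := ih U hU hUT
  have h3 : y U * pr k a0 = y U * a := by
    rw [← pr_mul (Hom_y U) k a0, h1]
    exact ((Hom_y U).mul hka).pr_eq
  have h4 : ∀ v ∈ E, v ∉ U → yv F v * pr k a0 = 0 := by
    intro v hv hvU
    rw [← pr_mul (Hom_yv (hA.ne v hv)) k a0, h2 v hv hvU, map_zero]
  apply min_ns hP hA hmin hM.toPre hM.mn (k := k) (by omega) (by omega) (hP.gr a0 ha0 k)
    (Hom_pr k a0) h4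
  have h5 := hhr U hU k _ (hP.gr a0 ha0 k) (Hom_pr k a0) hk (by
    rw [show dm T - dm U - 2 * k + 1 = 1 by omega, pow_one, mul_right_comm, h3, mul_comm, LE,
      Finset.sum_mul]
    apply Finset.sum_eq_zero
    intro v hv
    rw [← mul_assoc]; exact h0 v hv) (by rw [h3]; exact hne)
  rw [show dm T - dm U - 2 * k = 0 by omega, pow_zero, mul_one] at h5
  intro h6
  rw [h6, mul_zero] at h5
  exact lt_irrefl _ h5

end Finish
end HW


namespace HW
open Classical
set_option linter.unusedSectionVars false

section Base
variable {F V : Type*} [Field F] [AddCommGroup V] [Module F V] [Finite V]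

/-- All nonzero vectors of a subspace. -/
noncomputable def Ea (T : Submodule F V) : Finset V :=
  (Set.toFinite {v : V | v ∈ T ∧ v ≠ 0}).toFinset

theorem mem_Ea {T : Submodule F V} {v : V} : v ∈ Ea T ↔ v ∈ T ∧ v ≠ 0 := by
  simp [Ea]

theorem Adm_Ea (T : Submodule F V) : Adm T (Ea T) := by
  refine ⟨fun v hv => (mem_Ea.mp hv).2, le_antisymm ?_ ?_⟩
  · rw [Submodule.span_le]; intro v hv; exact (mem_Ea.mp hv).1
  · intro v hv
    by_cases h0 : v = 0
    · rw [h0]; exact Submodule.zero_mem _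
    · exact Submodule.subset_span (mem_Ea.mpr ⟨hv, h0⟩)

theorem card_diff {T Z : Submodule F V} (hZ : Z ≤ T) :
    ((Ea T).filter (· ∉ Z)).card = Nat.card F ^ dm T - Nat.card F ^ dm Z := by
  rw [← Module.natCard_eq_pow_finrank (K := F) (V := T), ← Module.natCard_eq_pow_finrank (K := F) (V := Z)]
  have h1 : (((Ea T).filter (· ∉ Z) : Finset V) : Set V) = (T : Set V) \ (Z : Set V) := by
    ext v; simp only [Finset.coe_filter, mem_Ea]
    constructor
    · rintro ⟨⟨h, _⟩, h2⟩; exact ⟨h, h2⟩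
    · rintro ⟨h, h2⟩
      exact ⟨⟨h, fun h0 => h2 (by rw [h0]; exact Z.zero_mem)⟩, h2⟩
  rw [← Set.ncard_coe_finset, h1, Set.ncard_sdiff (by exact_mod_cast hZ)]
  rfl

theorem kappa (T : Submodule F V) (j : ℕ) :
    ∃ c : ℝ, 0 < c ∧ ∀ Z ≤ T, dm Z + j = dm T → (y Z * LE F (Ea T) ^ j) T = c := by
  induction j with
  | zero =>
    refine ⟨1, one_pos, ?_⟩
    intro Z hZ h
    rw [eq_of_dm hZ (by omega), pow_zero, mul_one, y_app, if_pos rfl]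
  | succ j ih =>
    obtain ⟨c, hc, h⟩ := ih
    by_cases hd : j + 1 ≤ dm T
    swap
    · exact ⟨1, one_pos, fun Z _ h => by omega⟩
    have key : ∀ Z ≤ T, dm Z + (j + 1) = dm T → (y Z * LE F (Ea T) ^ (j + 1)) T =
        (((Ea T).filter (· ∉ Z)).card : ℝ) * c := by
      intro Z hZ hdZ
      have : y Z * LE F (Ea T) ^ (j + 1) = ∑ v ∈ Ea T, yv F v * y Z * LE F (Ea T) ^ j := by
        rw [pow_succ, ← Finset.sum_mul, ← Finset.sum_mul]; unfold LE; ring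
      rw [this, sum_app, ← Finset.sum_filter_add_sum_filter_not (Ea T) (· ∉ Z),
        Finset.sum_congr rfl (g := fun _ => c), Finset.sum_const, nsmul_eq_mul,
        Finset.sum_eq_zero, add_zero]
      · intro v hv
        rw [Finset.mem_filter, not_not, mem_Ea] at hv
        rw [yv_mul_mem hv.1.2 hv.2, zero_mul, zero_app]
      · intro v hv
        rw [Finset.mem_filter, mem_Ea] at hv
        rw [yv_mul_not hv.2]
        exact h _ (sup_le hZ (ln_le hv.1.1)) (by rw [dm_sup_ln hv.2]; omega)
    by_cases hex : ∃ Z ≤ T, dm Z + (j + 1) = dm T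
    swap
    · exact ⟨1, one_pos, fun Z hZ h => (hex ⟨Z, hZ, h⟩).elim⟩
    obtain ⟨Z, hZ, hdZ⟩ := hex
    refine ⟨(((Ea T).filter (· ∉ Z)).card : ℝ) * c, ?_, ?_⟩
    rotate_left
    · intro Z' hZ' hdZ'
      rw [key Z' hZ' hdZ', card_diff hZ', show dm Z' = dm Z by omega, ← card_diff hZ]
    · apply mul_pos _ hc
      obtain ⟨v, hv, hvZ⟩ := (Adm_Ea T).exists_not_mem (U := Z) (fun hle => by
        have := dm_mono hle; omega)
      exact_mod_cast Finset.card_pos.mpr ⟨v, Finset.mem_filter.mpr ⟨hv, hvZ⟩⟩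

theorem exists_compl_le {A W : Submodule F V} (h : A ≤ W) : ∃ C, Disjoint A C ∧ A ⊔ C = W := by
  obtain ⟨C, hC⟩ := exists_isCompl A
  refine ⟨C ⊓ W, hC.disjoint.mono_right inf_le_left, ?_⟩
  rw [← sup_inf_assoc_of_le _ h, hC.sup_eq_top, top_inf_eq]

/-- Pairing with powers of the Lefschetz element. -/
theorem pair_L (T : Submodule F V) (j : ℕ) :
    ∃ c : ℝ, 0 < c ∧ ∀ W ≤ T, ∀ x : GrM F V, ∀ m, RT T x → Hom m x → dm W + m + j = dm T →
      (y W * x * LE F (Ea T) ^ j) T = c * ∑ X, if Disjoint W X then x X else 0 := by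
  obtain ⟨c, hc, h⟩ := kappa T j
  refine ⟨c, hc, ?_⟩
  intro W hW x m hx hm hd
  conv_lhs => rw [eq_sum_y x]
  rw [Finset.mul_sum, Finset.sum_mul, sum_app, Finset.mul_sum]
  apply Finset.sum_congr rfl
  intro X _
  by_cases hX : x X = 0
  · rw [hX]; simp
  rw [mul_smul_comm, smul_mul_assoc, smul_app]
  split_ifs with hdis
  · rw [y_mul_of_disj hdis, h _ (sup_le hW (hx X hX)) (by rw [dm_sup hdis, hm X hX]; omega)]; ring
  · rw [y_mul_of_not hdis, zero_mul, zero_app]; ring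

noncomputable instance : LocallyFiniteOrder (Submodule F V) := Fintype.toLocallyFiniteOrder

/-- Möbius function of the subspace lattice. -/
noncomputable def mo (U S : Submodule F V) : ℝ := IncidenceAlgebra.mu ℝ U S

theorem sum_mo (U W : Submodule F V) : ∑ S ∈ Finset.Icc U W, mo U S = if U = W then 1 else 0 :=
  IncidenceAlgebra.sum_Icc_mu_right U W

theorem weisner {U : Submodule F V} {v : V} (hv : v ∉ U) (n : ℕ) :
    ∀ W, dm W = n → U ≤ W → v ∈ W → ∑ S ∈ (Finset.Icc U W).filter (fun S => S ⊔ ln v = W), mo U S = 0 := by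
  induction n using Nat.strong_induction_on with
  | _ n ih =>
  intro W hn hUW hvW
  have h1 := sum_mo U W
  rw [if_neg (by rintro rfl; exact hv hvW)] at h1
  rw [← Finset.sum_fiberwise_of_maps_to (s := Finset.Icc U W) (t := Finset.Icc (U ⊔ ln v) W)
    (g := fun S => S ⊔ ln v)] at h1
  swap
  · intro S hS
    rw [Finset.mem_Icc] at hS ⊢
    exact ⟨sup_le_sup_right hS.1 _, sup_le hS.2 (ln_le hvW)⟩
  rw [Finset.sum_eq_single_of_mem W (by
    rw [Finset.mem_Icc]; exact ⟨sup_le hUW (ln_le hvW), le_rfl⟩)] at h1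
  · exact h1
  · intro Z hZ hne
    rw [Finset.mem_Icc] at hZ
    have hlt : dm Z < n := by
      by_contra hc
      exact hne (eq_of_dm hZ.2 (by omega))
    have := ih _ hlt Z rfl (le_sup_left.trans hZ.1)
      (hZ.1 (le_sup_right (a := U) (Submodule.mem_span_singleton_self v)))
    rw [← this]
    apply Finset.sum_congr _ (fun _ _ => rfl)
    ext S
    simp only [Finset.mem_filter, Finset.mem_Icc]
    constructor
    · rintro ⟨⟨h, h'⟩, h''⟩; exact ⟨⟨h, h'' ▸ le_sup_left⟩, h''⟩
    · rintro ⟨⟨h, h'⟩, h''⟩; exact ⟨⟨h, h'.trans hZ.2⟩, h''⟩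

theorem mo_sign (U : Submodule F V) (n : ℕ) :
    ∀ W, U ≤ W → dm W = dm U + n → 0 < (-1 : ℝ) ^ n * mo U W := by
  induction n with
  | zero =>
    intro W hUW hd
    have := eq_of_dm hUW (by omega)
    subst this
    have h := sum_mo U U
    rw [if_pos rfl, Finset.Icc_self, Finset.sum_singleton] at h
    rw [h]; norm_num
  | succ n ih =>
    intro W hUW hd
    obtain ⟨v, hvW, hv⟩ : ∃ v ∈ W, v ∉ U := by
      by_contra! hc
      have := dm_mono (show W ≤ U from hc); omega
    have hW := weisner hv _ W rfl hUW hvW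
    rw [← Finset.add_sum_erase _ _ (a := W) (by
      rw [Finset.mem_filter, Finset.mem_Icc]
      exact ⟨⟨hUW, le_rfl⟩, sup_eq_left.mpr (ln_le hvW)⟩)] at hW
    rw [eq_neg_of_add_eq_zero_left hW, pow_succ, show ∀ s : ℝ, (-1 : ℝ) ^ n * -1 * -s = (-1) ^ n * s from
      fun s => by ring, Finset.mul_sum]
    have hdim : ∀ S, S ⊔ ln v = W → v ∉ S → dm S = dm U + n := by
      intro S h1 h2
      have := dm_sup_ln h2
      rw [h1] at this; omega
    apply Finset.sum_pos
    · intro S hS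
      rw [Finset.mem_erase, Finset.mem_filter, Finset.mem_Icc] at hS
      have hvS : v ∉ S := by
        intro h
        apply hS.1
        rw [← hS.2.2]; exact (sup_eq_left.mpr (ln_le h)).symm
      exact ih S hS.2.1.1 (hdim S hS.2.2 hvS)
    · obtain ⟨C, hC, hCW⟩ := exists_compl_le (A := U ⊔ ln v) (W := W) (sup_le hUW (ln_le hvW))
      have h1 : (U ⊔ C) ⊔ ln v = W := by rw [← hCW]; ac_rfl
      refine ⟨U ⊔ C, ?_⟩
      rw [Finset.mem_erase, Finset.mem_filter, Finset.mem_Icc]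
      refine ⟨?_, ⟨le_sup_left, by rw [← h1]; exact le_sup_left⟩, h1⟩
      intro h2
      have e1 := dm_sup (hC.mono_left (le_sup_left (a := U) (b := ln v)))
      have e2 := dm_sup hC
      rw [hCW, dm_sup_ln hv] at e2
      rw [h2] at e1
      omega

theorem mo_ne {U W : Submodule F V} (h : U ≤ W) : mo U W ≠ 0 := by
  intro h0
  have := mo_sign U (dm W - dm U) W h (by have := dm_mono h; omega)
  rw [h0, mul_zero] at this
  exact lt_irrefl _ this

/-- upper sums -/
noncomputable def gg (b : GrM F V) (W : Submodule F V) : ℝ := ∑ X, if W ≤ X then b X else 0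
/-- meet sums -/
noncomputable def GG (U : Submodule F V) (b : GrM F V) (W : Submodule F V) : ℝ :=
  ∑ X, if X ⊓ W = U then b X else 0

theorem GG_eq {U : Submodule F V} {b : GrM F V} (hb : ∀ X, b X ≠ 0 → U ≤ X) {W : Submodule F V} :
    GG U b W = ∑ S ∈ Finset.Icc U W, mo U S * gg b S := by
  unfold GG gg
  simp_rw [Finset.mul_sum]
  rw [Finset.sum_comm]
  apply Finset.sum_congr rfl
  intro X _
  by_cases hX : b X = 0
  · simp [hX]
  have h := sum_mo U (X ⊓ W)
  have e : Finset.Icc U (X ⊓ W) = (Finset.Icc U W).filter (fun S => S ≤ X) := by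
    ext S; simp only [Finset.mem_filter, Finset.mem_Icc, le_inf_iff]; tauto
  rw [e, Finset.sum_filter] at h
  have h2 : ∑ S ∈ Finset.Icc U W, mo U S * (if S ≤ X then b X else 0) =
      (∑ S ∈ Finset.Icc U W, if S ≤ X then mo U S else 0) * b X := by
    rw [Finset.sum_mul]
    apply Finset.sum_congr rfl
    intro S _; split_ifs <;> simp
  rw [h2, h]
  by_cases hu : X ⊓ W = U
  · rw [if_pos hu, if_pos hu.symm, one_mul]
  · rw [if_neg hu, if_neg (Ne.symm hu), zero_mul]

theorem GG_step {U : Submodule F V} {b : GrM F V} (hb : ∀ X, b X ≠ 0 → U ≤ X) (n : ℕ) :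
    ∀ W, dm W = n → U ≤ W → (∀ S, U ≤ S → S < W → GG U b S = 0) → GG U b W = mo U W * gg b W := by
  induction n using Nat.strong_induction_on with
  | _ n ih =>
  intro W hn hUW h
  rw [GG_eq hb, Finset.sum_eq_single_of_mem W (Finset.mem_Icc.mpr ⟨hUW, le_rfl⟩)]
  intro S hS hne
  rw [Finset.mem_Icc] at hS
  have hlt : S < W := lt_of_le_of_ne hS.2 hne
  have := ih (dm S) (by rw [← hn]; exact Submodule.finrank_lt_finrank_of_lt hlt) S rfl hS.1
    (fun S' h1 h2 => h S' h1 (h2.trans hlt))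
  rw [← this, h S hS.1 hlt]

theorem gg_top {b : GrM F V} {n : ℕ} (hb : Hom n b) {W : Submodule F V} (hW : dm W = n) :
    gg b W = b W := by
  unfold gg
  rw [Finset.sum_eq_single W]
  · simp
  · intro X _ hne
    split_ifs with h
    · by_contra hX
      exact hne (eq_of_dm h (by rw [hb X hX, hW])).symm
    · rfl
  · simp

theorem y_mul_supp {W X : Submodule F V} {b : GrM F V} (h : (y W * b) X ≠ 0) : W ≤ X := by
  by_contra hc
  apply h
  rw [eq_sum_y b, Finset.mul_sum, sum_app]
  apply Finset.sum_eq_zero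
  intro Y _
  rw [mul_smul_comm, smul_app, y_mul]
  split_ifs with hd
  · rw [y_app, if_neg, mul_zero]
    rintro rfl; exact hc le_sup_left
  · simp

theorem y_mul_self (U : Submodule F V) (b : GrM F V) : (y U * b) U = b ⊥ := by
  conv_lhs => rw [eq_sum_y b]
  rw [Finset.mul_sum, sum_app, Finset.sum_eq_single ⊥]
  · rw [mul_smul_comm, ← one_def, mul_one, smul_app, y_app, if_pos rfl, mul_one]
  · intro Y _ hne
    rw [mul_smul_comm, smul_app, y_mul]
    split_ifs with hd
    · rw [y_app, if_neg, mul_zero]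
      intro h
      apply hne
      have : Y ≤ U := by rw [h]; exact le_sup_right
      exact (disjoint_self.mp (hd.mono_left this))
    · simp
  · simp

theorem pair_GG (T : Submodule F V) (j : ℕ) :
    ∃ c : ℝ, 0 < c ∧ ∀ U W : Submodule F V, U ≤ W → W ≤ T → ∀ a : GrM F V, ∀ m, RT T a → Hom m a →
      dm W + m + j = dm T → (y W * a * LE F (Ea T) ^ j) T = c * GG U (y U * a) W := by
  obtain ⟨c, hc, h⟩ := pair_L T j
  refine ⟨c, hc, ?_⟩
  intro U W hUW hWT a m ha hm hd
  obtain ⟨C, hC, hCW⟩ := exists_compl_le hUW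
  have e2 := dm_sup hC
  rw [hCW] at e2
  rw [← hCW, ← y_mul_of_disj hC, show y U * y C * a * LE F (Ea T) ^ j =
    y C * (y U * a) * LE F (Ea T) ^ j by ring,
    h C (le_trans (by rw [← hCW]; exact le_sup_right) hWT) (y U * a) (dm U + m)
      ((RT_y (hUW.trans hWT)).mul ha) ((Hom_y U).mul hm) (by omega)]
  congr 1
  unfold GG
  apply Finset.sum_congr rfl
  intro X _
  by_cases hX : (y U * a) X = 0
  · rw [hX]; simp
  have hUX := y_mul_supp hX
  have : Disjoint C X ↔ X ⊓ (U ⊔ C) = U := by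
    rw [inf_comm, sup_inf_assoc_of_le _ hUX]
    constructor
    · intro h; rw [h.eq_bot, sup_bot_eq]
    · intro h
      rw [disjoint_iff, eq_bot_iff]
      have h1 : C ⊓ X ≤ U := by rw [← h]; exact le_sup_right
      exact hC h1 inf_le_left
  simp only [this]

/-- The full module. -/
def NT (T : Submodule F V) : Submodule ℝ (GrM F V) where
  carrier := {a | RT T a}
  add_mem' := fun ha hb => RT.add ha hb
  zero_mem' := RT_zero T
  smul_mem' := fun c _ ha => RT.smul c ha

theorem mem_NT {T : Submodule F V} {a : GrM F V} : a ∈ NT T ↔ RT T a := Iff.rfl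

theorem base_pdh {T : Submodule F V} {a : GrM F V} {k : ℕ} (hk : k ≤ dm T) (ha : RT T a) (hh : Hom k a)
    (h : ∀ b, RT T b → (a * b) T = 0) : a = 0 := by
  have hG : ∀ W ≤ T, GG ⊥ a W = 0 := by
    intro W hW
    by_cases hd : dm W + k ≤ dm T
    · obtain ⟨c, hc, hp⟩ := pair_GG T (dm T - dm W - k)
      have h1 := hp ⊥ W bot_le hW a k ha hh (by omega)
      rw [← one_def, one_mul, show y W * a * LE F (Ea T) ^ (dm T - dm W - k) =
        a * (y W * LE F (Ea T) ^ (dm T - dm W - k)) by ring, h] at h1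
      · rcases mul_eq_zero.mp h1.symm with h2 | h2
        · exact absurd h2 hc.ne'
        · exact h2
      · exact (RT_y hW).mul (RT.pow (RT.sum fun v hv => RT_yv (mem_Ea.mp hv).1) _)
    · unfold GG
      apply Finset.sum_eq_zero
      intro X _
      split_ifs with hX
      · by_contra hne
        have h1 := hh X hne
        have h2 := dm_sup (disjoint_iff.mpr hX)
        have h3 := dm_mono (sup_le (ha X hne) hW)
        omega
      · rfl
  apply GrM.ext'
  intro X
  by_contra hX
  have hXT := ha X hX
  have h1 := GG_step (U := ⊥) (b := a) (fun _ _ => bot_le) _ X rfl bot_le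
    (fun S _ hS => hG S (hS.le.trans hXT))
  rw [hG X hXT, gg_top hh (hh X hX)] at h1
  rcases mul_eq_zero.mp h1.symm with h2 | h2
  · exact mo_ne bot_le h2
  · exact hX h2

theorem base_pd {T : Submodule F V} {a : GrM F V} (ha : RT T a)
    (h : ∀ b, RT T b → (a * b) T = 0) : a = 0 := by
  rw [sum_pr a]
  apply Finset.sum_eq_zero
  intro k _
  by_cases hk : k ≤ dm T
  · apply base_pdh hk (ha.pr k) (Hom_pr k a)
    intro b hb
    rw [mul_app_pr (Hom_pr k a) hk, mul_comm]
    have := mul_app_pr (Hom_pr (dm T - k) b) (T := T) (by omega) a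
    rw [show dm T - (dm T - k) = k by omega] at this
    rw [← this, mul_comm]
    exact h _ (hb.pr _)
  · apply GrM.ext'
    intro X
    rw [pr_app]
    split_ifs with hX
    · by_contra hne
      have := dm_mono (ha X hne); omega
    · rfl

theorem base_Pre (T : Submodule F V) : Pre T (Ea T) (NT T) where
  rt := fun a ha => ha
  gr := fun a ha k => RT.pr ha k
  one := RT_one
  mul := fun v hv a ha => RT.mul (RT_yv (mem_Ea.mp hv).1) ha
  pd := fun a ha h => base_pd ha h

theorem base_HR {T U : Submodule F V} (hU : U ≤ T) : HR T U (NT T) (LE F (Ea T)) := by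
  intro k a ha hk h2 h0 hne
  have hdU := dm_mono hU
  set L := LE F (Ea T) with hL
  have hb : ∀ X, (y U * a) X ≠ 0 → U ≤ X := fun X hX => y_mul_supp hX
  have hbH : Hom (dm U + k) (y U * a) := (Hom_y U).mul hk
  have hbR : RT T (y U * a) := (RT_y hU).mul ha
  have hG : ∀ W, U ≤ W → W ≤ T → dm W < dm U + k → GG U (y U * a) W = 0 := by
    intro W hUW hWT hd
    have := dm_mono hUW
    obtain ⟨c, hc, hp⟩ := pair_GG T (dm T - dm W - k)
    have h1 := hp U W hUW hWT a k ha hk (by omega)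
    obtain ⟨C, hC, hCW⟩ := exists_compl_le hUW
    have e : y W * a * L ^ (dm T - dm W - k) = 0 := by
      rw [show dm T - dm W - k = (dm T - dm U - 2 * k + 1) + (dm U + k - dm W - 1) by omega, pow_add,
        ← hCW, ← y_mul_of_disj hC]
      have : ∀ p q : GrM F V, y U * y C * a * (p * q) = y C * q * (y U * p * a) := fun p q => by ring
      rw [this, h0, mul_zero]
    rw [← hL, e, zero_app] at h1
    rcases mul_eq_zero.mp h1.symm with h2 | h2
    · exact absurd h2 hc.ne'
    · exact h2
  obtain ⟨c, hc, hp⟩ := pair_GG T (dm T - dm U - 2 * k)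
  have key : (y U * L ^ (dm T - dm U - 2 * k) * a * a) T =
      ∑ W, c * ((y U * a) W * (y U * a) W * mo U W) := by
    have e : y U * L ^ (dm T - dm U - 2 * k) * a * a =
        ∑ W, (y U * a) W • (y W * a * L ^ (dm T - dm U - 2 * k)) := by
      calc y U * L ^ (dm T - dm U - 2 * k) * a * a =
          (y U * a) * (a * L ^ (dm T - dm U - 2 * k)) := by ring
        _ = _ := by
          conv_lhs => rw [eq_sum_y (y U * a)]
          rw [Finset.sum_mul]
          apply Finset.sum_congr rfl
          intro W _
          rw [smul_mul_assoc, mul_assoc]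
    rw [e, sum_app]
    apply Finset.sum_congr rfl
    intro W _
    rw [smul_app]
    by_cases hW : (y U * a) W = 0
    · rw [hW]; ring
    have hUW := hb W hW
    have hWT := hbR W hW
    have hdW := hbH W hW
    rw [hp U W hUW hWT a k ha hk (by omega), GG_step hb _ W rfl hUW, gg_top hbH hdW]
    · ring
    · intro S h1 h2
      apply hG S h1 (h2.le.trans hWT)
      rw [← hdW]; exact Submodule.finrank_lt_finrank_of_lt h2
  rw [key, Finset.mul_sum]
  have hterm : ∀ W, (y U * a) W ≠ 0 →
      0 < (-1 : ℝ) ^ k * (c * ((y U * a) W * (y U * a) W * mo U W)) := by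
    intro W hW
    have h1 := mo_sign U k W (hb W hW) (hbH W hW)
    have h3 : 0 < (y U * a) W * (y U * a) W := mul_self_pos.mpr hW
    have := mul_pos (mul_pos hc h3) h1
    calc _ < _ := this
      _ = _ := by ring
  apply Finset.sum_pos'
  · intro W _
    by_cases hW : (y U * a) W = 0
    · rw [hW]; simp
    · exact (hterm W hW).le
  · by_contra! hcon
    apply hne
    apply GrM.ext'
    intro W
    by_contra hW
    exact absurd (hterm W hW) (not_lt.mpr (hcon W (Finset.mem_univ _)))

theorem yT_pair (T : Submodule F V) (b : GrM F V) : (y T * b) T = b ⊥ := y_mul_self T b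

theorem socle {T : Submodule F V} {x : GrM F V} (hx : RT T x) (h : ∀ v ∈ Ea T, yv F v * x = 0) :
    x = x T • y T := by
  rw [← sub_eq_zero]
  apply base_pd
  · have := (NT T).sub_mem (mem_NT.mpr hx) ((NT T).smul_mem (x T) (mem_NT.mpr (RT_y (le_refl T))))
    exact this
  intro b hb
  rw [sub_mul, sub_app, smul_mul_assoc, smul_app, yT_pair]
  conv_lhs => rw [eq_sum_y b]
  rw [Finset.mul_sum, sum_app, Finset.sum_eq_single ⊥]
  · rw [mul_smul_comm, ← one_def, mul_one, smul_app, sum_app, Finset.sum_eq_single ⊥]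
    · rw [smul_app, y_app, if_pos rfl]; ring
    · intro W _ hW
      rw [smul_app, y_app, if_neg (Ne.symm hW), mul_zero]
    · simp
  · intro W _ hW
    by_cases hbW : b W = 0
    · rw [hbW]; simp
    obtain ⟨v, hv, hv0⟩ := (Submodule.ne_bot_iff W).mp hW
    obtain ⟨C, hC, hCW⟩ := exists_compl_le (ln_le hv)
    have : x * y W = 0 := by
      rw [← hCW, ← y_mul_of_disj hC]
      have := h v (mem_Ea.mpr ⟨hb W hbW hv, hv0⟩)
      unfold yv at this
      rw [← mul_assoc, mul_comm x, this, zero_mul]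
    rw [mul_smul_comm, this, smul_zero]; rfl
  · simp

theorem base_half (T : Submodule F V) : Half T (Ea T) (NT T) := by
  have hP := base_Pre T
  refine ⟨hP, fun U hU => base_HR (hU.le (Adm_Ea T)), ?_, ?_⟩
  · intro U hU k hk a ha hh h
    have hUT := hU.le (Adm_Ea T)
    have hs := socle (x := y U * a) ((RT_y hUT).mul ha) (fun v hv => by rw [← mul_assoc]; exact h v hv)
    rw [hs, ((Hom_y U).mul hh).app_eq_zero (by omega), zero_smul]
  · intro U hU a ha h
    have hUT := hU.le (Adm_Ea T)
    have hs := socle (x := y U * a) ((RT_y hUT).mul ha) (fun v hv => by rw [← mul_assoc]; exact h v hv)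
    obtain ⟨z, hz, hzb⟩ := exists_repr hP.pd (ev U)
    refine ⟨((y U * a) T) • z, (NT T).smul_mem _ hz, ?_, ?_⟩
    · conv_rhs => rw [hs]
      rw [mul_smul_comm]
      congr 1
      rw [← sub_eq_zero]
      apply base_pd
      · exact (NT T).sub_mem (mem_NT.mpr ((RT_y hUT).mul hz)) (mem_NT.mpr (RT_y (le_refl T)))
      · intro b hb
        rw [sub_mul, sub_app, yT_pair, mul_comm (y U) z, mul_assoc, hzb _ ((RT_y hUT).mul hb), ev_apply,
          y_mul_self, sub_self]
    · intro v hv hvU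
      have hvT := (mem_Ea.mp hv).1
      rw [mul_smul_comm]
      have : yv F v * z = 0 := by
        apply base_pd ((RT_yv hvT).mul hz)
        intro b hb
        rw [mul_comm (yv F v), mul_assoc, hzb _ ((RT_yv hvT).mul hb), ev_apply]
        by_contra hne
        exact hvU (y_mul_supp hne (Submodule.mem_span_singleton_self v))
      rw [this, smul_zero]

end Base
end HW


namespace HW
open Classical
set_option linter.unusedSectionVars false

section Main
variable {F V : Type*} [Field F] [AddCommGroup V] [Module F V] [Finite V]

theorem Fl.adm {T : Submodule F V} {E : Finset V} (hA : Adm T E) {U : Submodule F V} (h : Fl E U) :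
    Adm U (E.filter (· ∈ U)) := by
  refine ⟨fun v hv => hA.ne v (Finset.mem_filter.mp hv).1, ?_⟩
  conv_rhs => rw [← h]
  congr 1; ext x; simp

theorem exists_good (n : ℕ) : ∀ (T : Submodule F V) (E : Finset V), dm T = n → Adm T E →
    ∃ N, Good T E N := by
  induction n using Nat.strong_induction_on with
  | _ n ih =>
  intro T E hn
  have ih' : ∀ E : Finset V, Adm T E → ∀ U, Fl E U → U ≠ T → ∃ M, Good U (E.filter (· ∈ U)) M := by
    intro E hA U hU hne
    refine ih (dm U) ?_ U _ rfl (hU.adm hA)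
    by_contra hc
    exact hne (eq_of_dm (hU.le hA) (by omega))
  suffices H : ∀ m, ∀ E : Finset V, (Ea T \ E).card = m → Adm T E → ∃ N, Good T E N from H _ E rfl
  intro m
  induction m with
  | zero =>
    intro E hm hA
    have : E = Ea T := by
      apply Finset.Subset.antisymm
      · intro v hv; exact mem_Ea.mpr ⟨hA.mem hv, hA.ne v hv⟩
      · rwa [Finset.card_eq_zero, Finset.sdiff_eq_empty_iff_subset] at hm
    subst this
    exact finish hA (base_half T) (ih' _ hA)
  | succ m ihm =>
    intro E hm hA
    obtain ⟨e, he⟩ := Finset.card_pos.mp (by omega : 0 < (Ea T \ E).card)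
    have he' := Finset.mem_sdiff.mp he
    have heT := mem_Ea.mp he'.1
    have hA' : Adm T (insert e E) := by
      refine ⟨?_, ?_⟩
      · intro v hv
        rcases Finset.mem_insert.mp hv with rfl | hv
        · exact heT.2
        · exact hA.ne v hv
      · rw [Finset.coe_insert, Submodule.span_insert, hA.span]
        exact sup_eq_right.mpr (ln_le heT.1)
    obtain ⟨N, hN⟩ := ihm (insert e E) (by
      have e1 : Ea T \ insert e E = (Ea T \ E).erase e := by
        ext x; simp only [Finset.mem_sdiff, Finset.mem_insert, Finset.mem_erase]; tauto
      rw [e1]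
      rw [Finset.card_erase_of_mem he]; omega) hA'
    exact finish hA (step_half hA heT.1 heT.2 he'.2 hN) (ih' _ hA)

theorem LE_mul_y {E : Finset V} (hE : ∀ v ∈ E, v ≠ 0) (U : Submodule F V) :
    LE F E * y U = ∑ v ∈ E.filter (· ∉ U), y (U ⊔ ln v) := by
  unfold LE
  rw [Finset.sum_mul, Finset.sum_filter]
  apply Finset.sum_congr rfl
  intro v hv
  split_ifs with h
  · exact yv_mul_mem (hE v hv) h
  · exact yv_mul_not h

/-- Elements supported on flats of dimension `j`. -/
noncomputable def SF (F : Type*) {V : Type*} [Field F] [AddCommGroup V] [Module F V] [Finite V]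
    (E : Finset V) (j : ℕ) : Finset (Submodule F V) :=
  Finset.univ.filter (fun U => Fl E U ∧ dm U = j)

theorem card_le {T : Submodule F V} {E : Finset V} (hA : Adm T E) {j : ℕ} (hj : 2 * j < dm T) :
    (SF F E j).card ≤ (SF F E (j + 1)).card := by
  obtain ⟨N, hN⟩ := exists_good _ T E rfl hA
  have hHL := (hN.hr ⊥ (Fl_bot E)).toHL
  have hli : LinearIndependent ℝ (fun U : SF F E j => LE F E * y (U : Submodule F V)) := by
    rw [Fintype.linearIndependent_iff]
    intro c hc
    set a : GrM F V := ∑ U : SF F E j, c U • y (U : Submodule F V) with ha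
    have hLa : LE F E * a = 0 := by
      rw [ha, Finset.mul_sum, ← hc]
      apply Finset.sum_congr rfl
      intro U _; rw [mul_smul_comm]
    have hmem : ∀ U : SF F E j, Fl E (U : Submodule F V) ∧ dm (U : Submodule F V) = j := fun U =>
      (Finset.mem_filter.mp U.2).2
    have haN : a ∈ N := by
      apply Submodule.sum_mem
      intro U _
      apply Submodule.smul_mem
      have := hN.toPre.y_mem (hmem U).1 1 hN.one
      rwa [mul_one] at this
    have haH : Hom j a := Hom.sum (fun U _ => Hom.smul _ (by
      have := Hom_y (U : Submodule F V); rwa [(hmem U).2] at this))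
    have h0 : dm (⊥ : Submodule F V) = 0 := finrank_bot F V
    have h1 := hHL j a haN haH (by omega) (by
      rw [show dm T - dm (⊥ : Submodule F V) - 2 * j = (dm T - 2 * j - 1) + 1 by omega, pow_succ,
        mul_assoc, mul_assoc, hLa, mul_zero, mul_zero])
    rw [← one_def, one_mul] at h1
    intro U
    have h2 : a U = 0 := by rw [h1]; rfl
    rw [ha, sum_app, Finset.sum_eq_single U] at h2
    · rwa [smul_app, y_app, if_pos rfl, mul_one] at h2
    · intro W _ hW
      rw [smul_app, y_app, if_neg, mul_zero]
      intro h; exact hW (Subtype.ext h.symm)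
    · simp
  have hsub : Set.range (fun U : SF F E j => LE F E * y (U : Submodule F V)) ⊆
      (Submodule.span ℝ ((SF F E (j + 1)).image (fun U => y U) : Set (GrM F V)) : Set (GrM F V)) := by
    rintro _ ⟨U, rfl⟩
    have hU := (Finset.mem_filter.mp U.2).2
    simp only
    rw [LE_mul_y hA.ne]
    apply Submodule.sum_mem
    intro v hv
    have hv' := Finset.mem_filter.mp hv
    apply Submodule.subset_span
    rw [Finset.coe_image]
    refine ⟨U ⊔ ln v, ?_, rfl⟩
    simp only [SF, Finset.coe_filter, Finset.mem_univ, true_and]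
    exact ⟨hU.1.sup hv'.1, by rw [dm_sup_ln hv'.2, hU.2]⟩
  have h1 := linearIndependent_le_span_aux' _ hli
    ((SF F E (j + 1)).image (fun U => y U) : Set (GrM F V)) hsub
  rw [Fintype.card_coe] at h1
  refine h1.trans ?_
  rw [← Nat.card_eq_fintype_card, Nat.card_coe_set_eq, Set.ncard_coe_finset]
  exact Finset.card_image_le

end Main
end HW


namespace HW
open Classical
set_option linter.unusedSectionVars false

section Mat
variable {E : Type*} [Fintype E] [DecidableEq E]
variable {F V : Type*} [Field F] [AddCommGroup V] [Module F V]

theorem mrank_eq {M : FinMatroid E} {φ : E → V}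
    (h : ∀ I : Finset E, M.Indep I ↔ LinearIndepOn F φ (I : Set E)) (A : Finset E) :
    M.rank A = Module.finrank F (Submodule.span F (φ '' (A : Set E))) := by
  have hcard : ∀ I : Finset E, LinearIndepOn F φ (I : Set E) →
      Module.finrank F (Submodule.span F (φ '' (I : Set E))) = I.card := by
    intro I hI
    have := finrank_span_eq_card (R := F) (b := fun i : (I : Set E) => φ i) hI
    rw [Set.image_eq_range, this]; simp
  unfold FinMatroid.rank
  apply le_antisymm
  · apply Finset.sup_le
    intro I hI
    rw [Finset.mem_filter, Finset.mem_powerset, h] at hI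
    rw [← hcard I hI.2]
    have : FiniteDimensional F (Submodule.span F (φ '' (A : Set E))) :=
      FiniteDimensional.span_of_finite F ((Finset.finite_toSet A).image φ)
    apply Submodule.finrank_mono
    apply Submodule.span_mono
    apply Set.image_mono
    exact_mod_cast hI.1
  · obtain ⟨b, hbA, _, hsp, hb⟩ := exists_linearIndepOn_extension (K := F) (v := φ)
      (linearIndepOn_empty F φ) (Set.empty_subset (A : Set E))
    have hfin : b.Finite := (Finset.finite_toSet A).subset hbA
    have e : ((hfin.toFinset : Finset E) : Set E) = b := hfin.coe_toFinset
    have : Submodule.span F (φ '' (A : Set E)) = Submodule.span F (φ '' b) :=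
      le_antisymm (Submodule.span_le.mpr hsp) (Submodule.span_mono (Set.image_mono hbA))
    rw [this, ← e, hcard _ (by rw [e]; exact hb)]
    apply Finset.le_sup (f := Finset.card)
    rw [Finset.mem_filter, Finset.mem_powerset, h, e]
    refine ⟨?_, hb⟩
    intro x hx; exact hbA (hfin.mem_toFinset.mp hx)

theorem mem_mclosure {M : FinMatroid E} {φ : E → V}
    (h : ∀ I : Finset E, M.Indep I ↔ LinearIndepOn F φ (I : Set E)) (A : Finset E) (x : E) :
    x ∈ M.closure A ↔ φ x ∈ Submodule.span F (φ '' (A : Set E)) := by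
  unfold FinMatroid.closure
  rw [Finset.mem_filter, mrank_eq h, mrank_eq h]
  simp only [Finset.mem_univ, true_and]
  rw [Finset.coe_insert, Set.image_insert_eq]
  have hfd : FiniteDimensional F (Submodule.span F (insert (φ x) (φ '' (A : Set E)))) :=
    FiniteDimensional.span_of_finite F (((Finset.finite_toSet A).image φ).insert _)
  constructor
  · intro he
    have := Submodule.eq_of_le_of_finrank_eq (Submodule.span_mono (R := F) (Set.subset_insert (φ x) (φ '' (A : Set E)))) he.symm
    rw [this]
    exact Submodule.subset_span (Set.mem_insert _ _)
  · intro he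
    rw [Submodule.span_insert_eq_span he]

theorem mflat_iff {M : FinMatroid E} {φ : E → V}
    (h : ∀ I : Finset E, M.Indep I ↔ LinearIndepOn F φ (I : Set E)) (A : Finset E) :
    M.IsFlat A ↔ ∀ x, φ x ∈ Submodule.span F (φ '' (A : Set E)) ↔ x ∈ A := by
  unfold FinMatroid.IsFlat
  rw [Finset.ext_iff]
  simp only [mem_mclosure h]

theorem whitney_eq [Finite V] {M : FinMatroid E} {φ : E → V}
    (h : ∀ I : Finset E, M.Indep I ↔ LinearIndepOn F φ (I : Set E)) (k : ℕ) :
    M.whitneySecond k = (SF F (Finset.univ.image φ) k).card := by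
  unfold FinMatroid.whitneySecond
  have hsp : ∀ U : Submodule F V, φ '' ((Finset.univ.filter (fun x => φ x ∈ U) : Finset E) : Set E) =
      {v | v ∈ Finset.univ.image φ ∧ v ∈ U} := by
    intro U
    ext v
    simp only [Set.mem_image, Finset.coe_filter, Finset.mem_univ, true_and, Finset.mem_image]
    constructor
    · rintro ⟨x, hx, rfl⟩; exact ⟨⟨x, rfl⟩, hx⟩
    · rintro ⟨⟨x, rfl⟩, hx⟩; exact ⟨x, hx, rfl⟩
  apply Finset.card_bij' (i := fun (A : Finset E) _ => Submodule.span F (φ '' (A : Set E)))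
    (j := fun (U : Submodule F V) _ => (Finset.univ.filter (fun x => φ x ∈ U) : Finset E))
  · intro A hA
    rw [Finset.mem_filter] at hA
    simp only [SF, Finset.mem_filter, Finset.mem_univ, true_and]
    refine ⟨?_, (mrank_eq h A).symm.trans hA.2.2⟩
    unfold Fl
    apply le_antisymm
    · rw [Submodule.span_le]; rintro v ⟨_, hv⟩; exact hv
    · rw [Submodule.span_le]
      rintro _ ⟨x, hx, rfl⟩
      apply Submodule.subset_span
      exact ⟨Finset.mem_image_of_mem _ (Finset.mem_univ _), Submodule.subset_span ⟨x, hx, rfl⟩⟩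
  · intro U hU
    simp only [SF, Finset.mem_filter, Finset.mem_univ, true_and] at hU
    have hU1 : Submodule.span F {v | v ∈ Finset.univ.image φ ∧ v ∈ U} = U := hU.1
    rw [Finset.mem_filter, mflat_iff h, mrank_eq h, hsp U, hU1]
    refine ⟨Finset.mem_univ _, ?_, hU.2⟩
    intro x; simp
  · intro A hA
    rw [Finset.mem_filter, mflat_iff h] at hA
    ext x
    simp only [Finset.mem_filter, Finset.mem_univ, true_and]
    exact hA.2.1 x
  · intro U hU
    simp only [SF, Finset.mem_filter, Finset.mem_univ, true_and] at hU
    have hU1 : Submodule.span F {v | v ∈ Finset.univ.image φ ∧ v ∈ U} = U := hU.1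
    show Submodule.span F (φ '' ((Finset.univ.filter (fun x => φ x ∈ U) : Finset E) : Set E)) = U
    rw [hsp U, hU1]

theorem whitney_step [Finite V] {M : FinMatroid E} {φ : E → V}
    (h : ∀ I : Finset E, M.Indep I ↔ LinearIndepOn F φ (I : Set E)) (hl : M.Loopless) {j : ℕ}
    (hj : 2 * j < M.rk) : M.whitneySecond j ≤ M.whitneySecond (j + 1) := by
  rw [whitney_eq h, whitney_eq h]
  have hA : Adm (Submodule.span F ((Finset.univ.image φ : Finset V) : Set V)) (Finset.univ.image φ) := by
    refine ⟨?_, rfl⟩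
    intro v hv
    rw [Finset.mem_image] at hv
    obtain ⟨x, _, rfl⟩ := hv
    intro h0
    have : x ∈ M.closure ∅ := by rw [mem_mclosure h, h0]; exact Submodule.zero_mem _
    rw [hl] at this
    exact absurd this (Finset.notMem_empty x)
  apply card_le hA
  rw [FinMatroid.rk, mrank_eq h] at hj
  rw [Finset.coe_image]
  exact hj

end Mat
end HW


namespace HW
open Classical
set_option linter.unusedSectionVars false

section Red
variable {E : Type*} [Fintype E] [DecidableEq E]

theorem exists_enum {K : Type*} [Field K] {d : ℕ} {ψ : E → Fin d → K}
    (hsp : Submodule.span K (Set.range ψ) = ⊤) {I : Set E} (hI : LinearIndepOn K ψ I) :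
    ∃ B : Fin d → E, I ⊆ Set.range B ∧ Function.Injective B ∧ LinearIndependent K (ψ ∘ B) := by
  obtain ⟨b, _, hIb, hb, hli⟩ := exists_linearIndepOn_extension (K := K) (v := ψ) hI
    (Set.subset_univ I)
  have htop : Submodule.span K (ψ '' b) = ⊤ := by
    rw [eq_top_iff, ← hsp, Submodule.span_le, ← Set.image_univ]; exact hb
  have hc : Fintype.card b = d := by
    have := finrank_span_eq_card (R := K) (b := fun i : b => ψ i) hli
    rw [← Set.image_eq_range, htop, finrank_top, Module.finrank_fin_fun] at this
    exact this.symm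
  let e : Fin d ≃ b := (Fintype.equivFinOfCardEq hc).symm
  refine ⟨fun i => (e i : E), ?_, fun i j hij => e.injective (Subtype.ext hij), ?_⟩
  · intro x hx
    exact ⟨e.symm ⟨x, hIb hx⟩, by simp⟩
  · exact LinearIndependent.comp (v := fun i : b => ψ i) hli e e.injective

theorem transfer {K k : Type*} [Field K] [Field k] {d : ℕ} {ψ : E → Fin d → K} {χ : E → Fin d → k}
    (hsp : Submodule.span K (Set.range ψ) = ⊤)
    (h : ∀ B : Fin d → E, LinearIndependent K (ψ ∘ B) → LinearIndependent k (χ ∘ B))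
    {I : Set E} (hI : LinearIndepOn K ψ I) : LinearIndepOn k χ I := by
  obtain ⟨B, hB, hinj, hli⟩ := exists_enum hsp hI
  have h1 := h B hli
  have h2 : LinearIndepOn k χ (Set.range B) := by
    have := (linearIndepOn_range_iff hinj χ (R := k)).mpr h1
    exact this
  exact h2.mono hB

theorem li_iff_det {K : Type*} [Field K] {d : ℕ} (v : Fin d → Fin d → K) :
    LinearIndependent K v ↔ (Matrix.of v).det ≠ 0 := by
  have := Matrix.linearIndependent_rows_iff_isUnit (A := Matrix.of v)
  rw [Matrix.isUnit_iff_isUnit_det, isUnit_iff_ne_zero] at this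
  exact this

theorem jac_int : IsJacobsonRing ℤ := by
  rw [isJacobsonRing_iff_prime_eq]
  intro P hP
  by_cases h : P = ⊥
  · subst h
    rw [eq_bot_iff]
    intro x hx
    rw [Ideal.mem_jacobson_bot] at hx
    have h1 := hx x
    rw [Int.isUnit_iff] at h1
    rw [Ideal.mem_bot]
    rcases h1 with h1 | h1 <;> nlinarith
  · have := hP.isMaximal h
    exact Ideal.jacobson_eq_self_of_isMaximal

theorem finite_of_fg_field (k : Type) [Field k] [inst : Algebra ℤ k] [Algebra.FiniteType ℤ k] : Finite k := by
  obtain rfl : inst = Ring.toIntAlgebra k := Subsingleton.elim _ _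
  have hj := jac_int
  have hf : Module.Finite ℤ k := finite_of_finite_type_of_isJacobsonRing ℤ k
  have hni : ¬ Function.Injective (algebraMap ℤ k) := by
    intro hinj
    have : Algebra.IsIntegral ℤ k := inferInstance
    exact Int.not_isField (isField_of_isIntegral_of_isField hinj (Field.toIsField k))
  rw [injective_iff_map_eq_zero] at hni
  push Not at hni
  obtain ⟨n, hn, hn0⟩ := hni
  apply Module.finite_of_fg_torsion
  intro x
  refine ⟨⟨n, mem_nonZeroDivisors_of_ne_zero hn0⟩, ?_⟩
  show n • x = 0
  rw [Algebra.smul_def, hn, zero_mul]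

theorem exists_finite_rep {K : Type} [Field K] {d : ℕ} (ψ : E → Fin d → K)
    (hsp : Submodule.span K (Set.range ψ) = ⊤) :
    ∃ (k : Type) (_ : Field k) (_ : Finite k) (χ : E → Fin d → k),
      ∀ I : Set E, LinearIndepOn K ψ I ↔ LinearIndepOn k χ I := by
  let S : Set K := Set.range (fun p : E × Fin d => ψ p.1 p.2) ∪
    Set.range (fun B : Fin d → E => ((Matrix.of (ψ ∘ B)).det)⁻¹)
  have hS : S.Finite := (Set.finite_range _).union (Set.finite_range _)
  let A : Subalgebra ℤ K := Algebra.adjoin ℤ S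
  have hA : Algebra.FiniteType ℤ A := by
    rw [← Subalgebra.fg_iff_finiteType]
    exact ⟨hS.toFinset, by rw [hS.coe_toFinset]⟩
  obtain ⟨m, hm⟩ := Ideal.exists_maximal A
  let _ : Field (A ⧸ m) := Ideal.Quotient.field m
  have hft : Algebra.FiniteType ℤ (A ⧸ m) :=
    Algebra.FiniteType.of_surjective (Ideal.Quotient.mkₐ ℤ m) Ideal.Quotient.mk_surjective
  have hfin : Finite (A ⧸ m) := finite_of_fg_field (A ⧸ m)
  let ψA : E → Fin d → A := fun e i => ⟨ψ e i, Algebra.subset_adjoin (Or.inl ⟨(e, i), rfl⟩)⟩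
  let q : A →+* A ⧸ m := Ideal.Quotient.mk m
  let χ : E → Fin d → A ⧸ m := fun e i => q (ψA e i)
  have hdK : ∀ B : Fin d → E, (Matrix.of (ψ ∘ B)).det = ((Matrix.of (ψA ∘ B)).det : K) := by
    intro B
    have := RingHom.map_det (A.val : A →+* K) (Matrix.of (ψA ∘ B))
    exact this.symm
  have hdk : ∀ B : Fin d → E, (Matrix.of (χ ∘ B)).det = q (Matrix.of (ψA ∘ B)).det := by
    intro B
    exact (RingHom.map_det q (Matrix.of (ψA ∘ B))).symm
  have hiff : ∀ B : Fin d → E, LinearIndependent K (ψ ∘ B) ↔ LinearIndependent (A ⧸ m) (χ ∘ B) := by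
    intro B
    rw [li_iff_det, li_iff_det, hdk B]
    constructor
    · intro h0 h1
      let u : A := ⟨((Matrix.of (ψ ∘ B)).det)⁻¹, Algebra.subset_adjoin (Or.inr ⟨B, rfl⟩)⟩
      have hu : (Matrix.of (ψA ∘ B)).det * u = 1 := by
        apply Subtype.ext
        show ((Matrix.of (ψA ∘ B)).det : K) * ((Matrix.of (ψ ∘ B)).det)⁻¹ = 1
        rw [← hdK B, mul_inv_cancel₀ h0]
      have := congrArg q hu
      rw [map_mul, h1, zero_mul, map_one] at this
      exact zero_ne_one this
    · intro h0 h1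
      apply h0
      rw [hdK B] at h1
      have : (Matrix.of (ψA ∘ B)).det = 0 := Subtype.ext h1
      rw [this, map_zero]
  have hsp' : Submodule.span (A ⧸ m) (Set.range χ) = ⊤ := by
    obtain ⟨B, _, _, hB⟩ := exists_enum hsp (linearIndepOn_empty K ψ)
    have hB' := (hiff B).mp hB
    have h1 := hB'.span_eq_top_of_card_eq_finrank' (by simp)
    rw [eq_top_iff, ← h1]
    apply Submodule.span_mono
    exact Set.range_comp_subset_range B χ
  exact ⟨A ⧸ m, inferInstance, hfin, χ, fun I =>
    ⟨transfer hsp (fun B => (hiff B).mp), transfer hsp' (fun B => (hiff B).mpr)⟩⟩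

theorem reduce {M : FinMatroid E} (hrep : M.Representable) :
    ∃ (k : Type) (_ : Field k) (_ : Finite k) (d : ℕ) (χ : E → Fin d → k),
      ∀ I : Finset E, M.Indep I ↔ LinearIndepOn k χ (I : Set E) := by
  obtain ⟨K, _, V, _, _, φ, hφ⟩ := hrep
  have hφ' : ∀ I : Finset E, M.Indep I ↔ LinearIndepOn K φ (I : Set E) := by
    intro I
    rw [hφ I]
    constructor
    · rintro ⟨hi, hl⟩
      exact (linearIndepOn_iff_image hi).mpr hl
    · intro hl
      have hi : Set.InjOn φ (I : Set E) := hl.injOn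
      exact ⟨hi, (linearIndepOn_iff_image hi).mp hl⟩
  let W := Submodule.span K (Set.range φ)
  have hW : FiniteDimensional K W := FiniteDimensional.span_of_finite K (Set.finite_range φ)
  let φW : E → W := fun e => ⟨φ e, Submodule.subset_span ⟨e, rfl⟩⟩
  let f : W ≃ₗ[K] (Fin (Module.finrank K W) → K) := (Module.finBasis K W).equivFun
  let ψ : E → Fin (Module.finrank K W) → K := fun e => f (φW e)
  have h1 : ∀ I : Set E, LinearIndepOn K ψ I ↔ LinearIndepOn K φ I := by
    intro I
    have e1 := LinearMap.linearIndepOn_iff_of_injOn (v := φW) (s := I) f.toLinearMap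
      (f.injective : Function.Injective f.toLinearMap).injOn
    have e2 := LinearMap.linearIndepOn_iff_of_injOn (v := φW) (s := I) W.subtype
      Subtype.val_injective.injOn
    exact e1.trans e2.symm
  have hsp : Submodule.span K (Set.range ψ) = ⊤ := by
    have e1 : Submodule.span K (Set.range φW) = ⊤ := by
      have := Submodule.span_span_coe_preimage (R := K) (s := Set.range φ)
      rw [← this]
      congr 1
      ext ⟨x, hx⟩
      simp [φW, Subtype.ext_iff]
    have e2 : Set.range ψ = f '' Set.range φW := by rw [← Set.range_comp]; rfl
    rw [e2]
    have := Submodule.map_span (f : W →ₗ[K] (Fin (Module.finrank K W) → K)) (Set.range φW)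
    rw [e1, Submodule.map_top, LinearEquiv.range] at this
    exact this.symm
  obtain ⟨k, hk1, hk2, χ, hχ⟩ := exists_finite_rep ψ hsp
  exact ⟨k, hk1, hk2, _, χ, fun I => by rw [hφ' I, ← h1, hχ]⟩

theorem main_mono {M : FinMatroid E} (hM : M.Loopless) (hrep : M.Representable) :
    ∀ j k : ℕ, j ≤ k → k ≤ M.rk / 2 → M.whitneySecond j ≤ M.whitneySecond k := by
  obtain ⟨k, _, _, d, χ, hχ⟩ := reduce hrep
  intro j l hjl
  induction l, hjl using Nat.le_induction with
  | base => intro _; exact le_rfl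
  | succ l hl ih =>
    intro h
    exact (ih (by omega)).trans (whitney_step hχ hM (by omega))

end Red
end HW

open FinMatroid in
/-- **Huh–Wang.** For a loopless matroid `M` of rank `r` representable over some field, the
first half of the sequence of Whitney numbers of the second kind is nondecreasing:
`W_1(M) ≤ W_2(M) ≤ ⋯ ≤ W_{⌊r/2⌋}(M)`. -/
theorem huh_wang_unimodal {E : Type*} [Fintype E] [DecidableEq E]
    (M : FinMatroid E) (hM : M.Loopless) (r : ℕ) (hr : M.rk = r)
    (hrep : M.Representable) :
    ∀ j k : ℕ, 1 ≤ j → j ≤ k → k ≤ r / 2 → M.whitneySecond j ≤ M.whitneySecond k := by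
  intro j k _ hjk hk
  exact HW.main_mono hM hrep j k hjk (by rw [hr]; exact hk)
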